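/- arXiv:2404.06327 — 3 statements merged into one kernel-verified Lean document; each statement's English description precedes it below -/
import Mathlib

section
/- There exist absolute constants K > 0 and c > 0 such that the following holds. For every integer q ≥ 2, all positive integers n, m with m ≤ q^n, every ε ∈ (0,1), and every additive subgroup 𝒞 of (ℤ_q)^m with |𝒞| ≤ q^n, there exists a (1±ε) code-sparsifier (S, w) of 𝒞 with |S| ≤ K·n·(log₂(2q))²·(log₂(2nq/ε))^c / ε². -/
namespace CodeSparsifier

open Finset

open scoped Classical in
/-- The coordinates of `A` that are the leading coordinate, within `A`, of some codeword. -/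
noncomputable def pivots {ι G : Type*} [LinearOrder ι] [AddCommGroup G]
    (C : AddSubgroup (ι → G)) (A : Finset ι) : Finset ι :=
  A.filter fun i => ∃ c ∈ C, c i ≠ 0 ∧ ∀ j ∈ A, j < i → c j = 0

theorem pivots_subset {ι G : Type*} [LinearOrder ι] [AddCommGroup G]
    (C : AddSubgroup (ι → G)) (A : Finset ι) : pivots C A ⊆ A := by
  classical exact filter_subset _ _

/-- A codeword vanishing on the pivots up to `k` vanishes on all coordinates up to `k`. -/
theorem eq_zero_of_pivots {ι G : Type*} [LinearOrder ι] [AddCommGroup G]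
    {C : AddSubgroup (ι → G)} {A : Finset ι} {k : ι} {c : ι → G} (hc : c ∈ C)
    (h : ∀ i ∈ pivots C A, i ≤ k → c i = 0) : ∀ i ∈ A, i ≤ k → c i = 0 := by
  classical
  by_contra! hne
  obtain ⟨i₀, hi₀, hk₀, hc₀⟩ := hne
  let T := A.filter fun i => i ≤ k ∧ c i ≠ 0
  have hT : T.Nonempty := ⟨i₀, by simp [T, *]⟩
  have hmem := T.min'_mem hT
  simp only [T, mem_filter] at hmem
  refine hmem.2.2 (h _ ?_ hmem.2.1)
  refine mem_filter.2 ⟨hmem.1, c, hc, hmem.2.2, fun j hj hlt => ?_⟩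
  by_contra hj0
  exact absurd (T.min'_le j (by simp [T, hj, hj0, (hlt.le.trans hmem.2.1)])) (not_le.2 hlt)

theorem two_pow_card_pivots_le {ι G : Type*} [Finite ι] [LinearOrder ι] [AddCommGroup G]
    [Finite G] (C : AddSubgroup (ι → G)) (A : Finset ι) :
    2 ^ (pivots C A).card ≤ Nat.card C := by
  classical
  have hp : ∀ i : ι, ∃ c ∈ C, i ∈ pivots C A → c i ≠ 0 ∧ ∀ j ∈ A, j < i → c j = 0 := by
    intro i
    by_cases hi : i ∈ pivots C A
    · obtain ⟨c, hc, h⟩ := (mem_filter.1 hi).2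
      exact ⟨c, hc, fun _ => h⟩
    · exact ⟨0, C.zero_mem, fun h => absurd h hi⟩
  choose f hfC hf using hp
  let F : (pivots C A).powerset → C := fun T => ⟨∑ i ∈ T.1, f i, C.sum_mem fun i _ => hfC i⟩
  have hF : Function.Injective F := by
    rintro ⟨T, hT⟩ ⟨T', hT'⟩ h
    have hs : ∑ i ∈ T, f i = ∑ i ∈ T', f i := congrArg Subtype.val h
    rw [mem_powerset] at hT hT'
    by_contra hne
    have hD : (symmDiff T T').Nonempty := by
      rw [nonempty_iff_ne_empty]
      intro h0
      exact hne (Subtype.ext (symmDiff_eq_bot.1 h0))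
    set i := (symmDiff T T').min' hD with hi
    have him : i ∈ symmDiff T T' := min'_mem _ _
    have hiP : i ∈ pivots C A := by
      rcases mem_symmDiff.1 him with h | h
      exacts [hT h.1, hT' h.1]
    have key : ∀ j ∈ symmDiff T T', j ≠ i → f j i = 0 := by
      intro j hj hji
      have hjP : j ∈ pivots C A := by
        rcases mem_symmDiff.1 hj with h | h
        exacts [hT h.1, hT' h.1]
      exact (hf j hjP).2 i (pivots_subset _ _ hiP) (lt_of_le_of_ne (min'_le _ _ hj) hji.symm)
    have hs' := congrFun hs i
    simp only [Finset.sum_apply] at hs'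
    rw [← sum_inter_add_sum_sdiff T T', ← sum_inter_add_sum_sdiff T' T, inter_comm T' T,
      add_right_inj] at hs'
    rcases mem_symmDiff.1 him with h | h
    · rw [sum_eq_single_of_mem i (mem_sdiff.2 h)
        (fun j hj hji => key j (mem_symmDiff.2 (Or.inl (mem_sdiff.1 hj))) hji),
        sum_eq_zero (fun j hj => key j (mem_symmDiff.2 (Or.inr (mem_sdiff.1 hj)))
          (fun e => (mem_sdiff.1 hj).2 (e ▸ h.1)))] at hs'
      exact (hf i hiP).1 hs'
    · rw [eq_comm, sum_eq_single_of_mem i (mem_sdiff.2 h)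
        (fun j hj hji => key j (mem_symmDiff.2 (Or.inr (mem_sdiff.1 hj))) hji),
        sum_eq_zero (fun j hj => key j (mem_symmDiff.2 (Or.inl (mem_sdiff.1 hj)))
          (fun e => (mem_sdiff.1 hj).2 (e ▸ h.1)))] at hs'
      exact (hf i hiP).1 hs'
  have := Nat.card_le_card_of_injective F hF
  rwa [Nat.card_eq_fintype_card, Fintype.card_coe, card_powerset] at this

/-- What remains of `A` after removing pivots `d` times. -/
noncomputable def peel {ι G : Type*} [LinearOrder ι] [AddCommGroup G]
    (C : AddSubgroup (ι → G)) (A : Finset ι) : ℕ → Finset ι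
  | 0 => A
  | d + 1 => peel C A d \ pivots C (peel C A d)

theorem peel_subset_of_le {ι G : Type*} [LinearOrder ι] [AddCommGroup G]
    (C : AddSubgroup (ι → G)) (A : Finset ι) {d e : ℕ} (h : d ≤ e) :
    peel C A e ⊆ peel C A d := by
  induction e, h using Nat.le_induction with
  | base => exact Subset.rfl
  | succ e _ ih => exact sdiff_subset.trans ih

theorem sum_eq_sum_pivots_add_sum_peel {ι G : Type*} [LinearOrder ι] [AddCommGroup G]
    (C : AddSubgroup (ι → G)) (A : Finset ι) (f : ι → ℝ) (d : ℕ) :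
    ∑ i ∈ A, f i =
      ∑ j ∈ range d, ∑ i ∈ pivots C (peel C A j), f i + ∑ i ∈ peel C A d, f i := by
  induction d with
  | zero => simp [peel]
  | succ d ih =>
    rw [ih, sum_range_succ, add_assoc, peel, add_comm (∑ i ∈ pivots C (peel C A d), f i),
      sum_sdiff (pivots_subset _ _)]

/-- Hoeffding's inequality for random signs, combined with a union bound. -/
theorem exists_signs {ι α : Type*} [Fintype ι] (J : Finset α) (X : α → Finset ι) (τ : α → ℝ)
    {l : ℝ} (hl : 0 < l)
    (h : ∑ a ∈ J, 2 * Real.exp (-l * τ a + l ^ 2 * (X a).card / 2) < 1) :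
    ∃ σ : ι → ℝ, (∀ i, σ i = 1 ∨ σ i = -1) ∧ ∀ a ∈ J, |∑ i ∈ X a, σ i| ≤ τ a := by
  classical
  let g : Bool → ℝ := fun b => if b then 1 else -1
  have mgf : ∀ (Y : Finset ι) (μ : ℝ), ∑ s : ι → Bool, Real.exp (μ * ∑ i ∈ Y, g (s i)) ≤
      2 ^ Fintype.card ι * Real.exp (μ ^ 2 * Y.card / 2) := by
    intro Y μ
    have h1 : ∀ s : ι → Bool, Real.exp (μ * ∑ i ∈ Y, g (s i)) =
        ∏ i, if i ∈ Y then Real.exp (μ * g (s i)) else 1 := by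
      intro s
      rw [mul_sum, Real.exp_sum, prod_ite_mem, univ_inter]
    simp_rw [h1]
    rw [← Fintype.prod_sum (fun i b => if i ∈ Y then Real.exp (μ * g b) else 1)]
    calc ∏ i, ∑ b : Bool, (if i ∈ Y then Real.exp (μ * g b) else 1)
        ≤ ∏ i : ι, 2 * (if i ∈ Y then Real.exp (μ ^ 2 / 2) else 1) := by
          refine prod_le_prod (fun i _ => sum_nonneg fun b _ => by split_ifs <;> positivity) ?_
          intro i _
          by_cases hi : i ∈ Y
          · have := Real.cosh_le_exp_half_sq μ
            rw [Real.cosh_eq] at this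
            simp only [hi, if_true, Fintype.sum_bool, g]
            simp only [Bool.false_eq_true, if_false, mul_one, mul_neg]
            linarith
          · simp [hi, one_add_one_eq_two]
      _ = _ := by
          rw [prod_mul_distrib, prod_ite_mem, univ_inter, prod_const, prod_const, card_univ,
            ← Real.exp_nat_mul]
          congr 2; ring
  let Φ : (ι → Bool) → ℝ := fun s => ∑ a ∈ J, (Real.exp (l * ∑ i ∈ X a, g (s i)) +
    Real.exp (-l * ∑ i ∈ X a, g (s i))) * Real.exp (-l * τ a)
  have hΦ : ∑ s, Φ s < ∑ _s : ι → Bool, (1 : ℝ) := by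
    calc ∑ s, Φ s = ∑ a ∈ J, (∑ s : ι → Bool, Real.exp (l * ∑ i ∈ X a, g (s i)) +
          ∑ s : ι → Bool, Real.exp (-l * ∑ i ∈ X a, g (s i))) * Real.exp (-l * τ a) := by
          simp only [Φ]
          rw [sum_comm]
          simp_rw [← sum_mul, sum_add_distrib]
      _ ≤ ∑ a ∈ J, 2 ^ Fintype.card ι *
          (2 * Real.exp (-l * τ a + l ^ 2 * (X a).card / 2)) := by
          refine sum_le_sum fun a _ => ?_
          have e1 := mgf (X a) l
          have e2 := mgf (X a) (-l)
          rw [neg_sq] at e2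
          rw [Real.exp_add]
          have := mul_le_mul_of_nonneg_right (add_le_add e1 e2) (Real.exp_nonneg (-l * τ a))
          linarith
      _ < 2 ^ Fintype.card ι := by
          rw [← mul_sum]
          exact mul_lt_of_lt_one_right (by positivity) h
      _ = _ := by simp
  obtain ⟨s, -, hs⟩ := exists_lt_of_sum_lt hΦ
  refine ⟨fun i => g (s i), fun i => ?_, fun a ha => ?_⟩
  · rcases Bool.eq_false_or_eq_true (s i) with h | h <;> simp [g, h]
  have h1 : (Real.exp (l * ∑ i ∈ X a, g (s i)) +
      Real.exp (-l * ∑ i ∈ X a, g (s i))) * Real.exp (-l * τ a) < 1 :=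
    (single_le_sum (f := fun a => (Real.exp (l * ∑ i ∈ X a, g (s i)) +
      Real.exp (-l * ∑ i ∈ X a, g (s i))) * Real.exp (-l * τ a))
      (fun a _ => by positivity) ha).trans_lt hs
  rw [add_mul, ← Real.exp_add, ← Real.exp_add] at h1
  have p1 := Real.exp_pos (l * ∑ i ∈ X a, g (s i) + -l * τ a)
  have p2 := Real.exp_pos (-l * ∑ i ∈ X a, g (s i) + -l * τ a)
  have q1 : l * ∑ i ∈ X a, g (s i) + -l * τ a < 0 := Real.exp_lt_one_iff.1 (by linarith)
  have q2 : -l * ∑ i ∈ X a, g (s i) + -l * τ a < 0 := Real.exp_lt_one_iff.1 (by linarith)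
  rw [abs_le]
  constructor <;> nlinarith

/-- The weight enumerator of the words over `G` supported on `T`. -/
theorem sum_pow_card_support {ι G : Type*} [Fintype ι] [DecidableEq ι] [Zero G] [Fintype G]
    [DecidableEq G] (T : Finset ι) {t : ℝ} (ht : 0 ≤ t) :
    ∑ u ∈ Fintype.piFinset (fun i => if i ∈ T then (univ : Finset G) else {0}),
      t ^ (univ.filter fun i => u i ≠ 0).card ≤ (1 + Fintype.card G * t) ^ T.card := by
  have h1 : ∀ u : ι → G, t ^ (univ.filter fun i => u i ≠ 0).card =
      ∏ i, if u i ≠ 0 then t else 1 := by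
    intro u
    rw [prod_ite, prod_const, prod_const_one, mul_one]
  simp_rw [h1]
  rw [← prod_univ_sum (fun i => if i ∈ T then (univ : Finset G) else {0})
    (fun _ a => if a ≠ 0 then t else 1)]
  calc _ ≤ ∏ i, (if i ∈ T then (1 + Fintype.card G * t) else 1) := by
        refine prod_le_prod (fun i _ => sum_nonneg fun b _ => by split_ifs <;> positivity) ?_
        intro i _
        by_cases hi : i ∈ T
        · simp only [hi, if_true]
          calc ∑ a : G, (if a ≠ 0 then t else 1) ≤ ∑ a : G, ((if a = 0 then 1 else 0) + t) :=
                sum_le_sum fun a _ => by by_cases h : a = 0 <;> simp [h, ht]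
            _ = _ := by simp [sum_add_distrib]
        · simp [hi]
    _ = _ := by rw [prod_ite_mem, univ_inter, prod_const]

/-- Signs on the coordinates left after peeling which, for every codeword and every initial
segment, are balanced up to an `ε` fraction of the weight of the codeword on that segment. -/
theorem exists_signs_peel {ι G : Type*} [Fintype ι] [LinearOrder ι] [AddCommGroup G] [Fintype G]
    [DecidableEq G] (C : AddSubgroup (ι → G)) (A : Finset ι) {N d : ℕ} (hC : Nat.card C ≤ 2 ^ N)
    (hd : 1 ≤ d) {ε : ℝ} (hε : 0 < ε)
    (h : 2 * A.card * d *
      ((1 + Fintype.card G * Real.exp (-ε ^ 2 * d / 2)) ^ N - 1) < 1) :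
    ∃ σ : ι → ℝ, (∀ i, σ i = 1 ∨ σ i = -1) ∧ ∀ c ∈ C, ∀ k ∈ A,
      |∑ i ∈ peel C A d with i ≤ k ∧ c i ≠ 0, σ i| ≤
        ε * (A.filter fun i => i ≤ k ∧ c i ≠ 0).card := by
  classical
  set t := Real.exp (-ε ^ 2 * d / 2) with ht
  have ht0 : 0 ≤ t := (Real.exp_pos _).le
  let T : ι × ℕ → Finset ι := fun p => (pivots C (peel C A p.2)).filter (· ≤ p.1)
  let U : ι × ℕ → Finset (ι → G) := fun p =>
    (Fintype.piFinset fun i => if i ∈ T p then (univ : Finset G) else {0}).erase 0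
  let s : (ι → G) → ℕ := fun u => (univ.filter fun i => u i ≠ 0).card
  let J : Finset (Σ _ : ι × ℕ, ι → G) := (A ×ˢ range d).sigma U
  let X : (Σ _ : ι × ℕ, ι → G) → Finset ι := fun a => (peel C A d).filter fun i =>
    i ≤ a.1.1 ∧ ∃ c ∈ C, (∀ i ∈ T a.1, c i = a.2 i) ∧ c i ≠ 0
  let τ : (Σ _ : ι × ℕ, ι → G) → ℝ := fun a => ε * (d * s a.2 + (X a).card) / 2
  have hT : ∀ p, (T p).card ≤ N := fun p =>
    (card_filter_le _ _).trans
      ((Nat.pow_le_pow_iff_right one_lt_two).1 ((two_pow_card_pivots_le _ _).trans hC))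
  have hU : ∀ p, ∑ u ∈ U p, t ^ s u ≤ (1 + Fintype.card G * t) ^ N - 1 := by
    intro p
    rw [sum_erase_eq_sub (by simp only [Fintype.mem_piFinset]; intro i; split_ifs <;> simp)]
    refine sub_le_sub ?_ (by simp [s])
    exact (sum_pow_card_support (T p) ht0).trans
      (pow_le_pow_right₀ (le_add_of_nonneg_right (by positivity)) (hT p))
  have hJ : ∑ a ∈ J, 2 * Real.exp (-ε * τ a + ε ^ 2 * (X a).card / 2) < 1 := by
    have h1 : ∀ a, Real.exp (-ε * τ a + ε ^ 2 * (X a).card / 2) = t ^ s a.2 := by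
      intro a
      rw [ht, ← Real.exp_nat_mul]
      congr 1
      simp only [τ]
      ring
    simp_rw [h1]
    rw [sum_sigma]
    calc _ ≤ ∑ p ∈ A ×ˢ range d, 2 * ((1 + Fintype.card G * t) ^ N - 1) :=
          sum_le_sum fun p _ => by
            rw [← mul_sum]
            exact mul_le_mul_of_nonneg_left (hU p) zero_le_two
      _ = 2 * A.card * d * ((1 + Fintype.card G * t) ^ N - 1) := by
          rw [sum_const, card_product, card_range, nsmul_eq_mul]
          push_cast
          ring
      _ < 1 := h
  obtain ⟨σ, hσ, hbal⟩ := exists_signs J X τ hε hJ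
  refine ⟨σ, hσ, fun c hc k hk => ?_⟩
  let v : ℕ → ℕ := fun j => ((T (k, j)).filter fun i => c i ≠ 0).card
  obtain ⟨j, hj, hmin⟩ := exists_min_image (range d) v ⟨0, mem_range.2 hd⟩
  have hdet : ∀ e ∈ C, (∀ i ∈ T (k, j), e i = 0) → ∀ i ∈ peel C A d, i ≤ k → e i = 0 := by
    intro e he h0 i hi hik
    refine eq_zero_of_pivots he (fun i hi hik => h0 i (mem_filter.2 ⟨hi, hik⟩)) i ?_ hik
    exact peel_subset_of_le C A (mem_range.1 hj).le hi
  let u : ι → G := fun i => if i ∈ T (k, j) then c i else 0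
  have hsu : s u = v j := by
    simp only [s, v]
    congr 1
    ext i
    simp [u]
  have hX : X ⟨(k, j), u⟩ = (peel C A d).filter fun i => i ≤ k ∧ c i ≠ 0 := by
    refine filter_congr fun i hi => and_congr_right fun hik => ⟨?_, fun hci => ?_⟩
    · rintro ⟨c', hc', hagree, hne⟩
      have := hdet (c' - c) (C.sub_mem hc' hc)
        (fun i hi => by simp [hagree i hi, u, hi]) i hi hik
      rw [Pi.sub_apply, sub_eq_zero] at this
      rwa [← this]
    · exact ⟨c, hc, fun i hi => by simp [u, hi], hci⟩
  have hcount : (d * v j + (X ⟨(k, j), u⟩).card : ℝ) ≤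
      (A.filter fun i => i ≤ k ∧ c i ≠ 0).card := by
    have h1 := sum_eq_sum_pivots_add_sum_peel C A (fun i => if i ≤ k ∧ c i ≠ 0 then 1 else 0) d
    simp only [sum_boole] at h1
    rw [h1, hX]
    refine add_le_add_left ?_ _
    have h2 : ∀ j' ∈ range d, (v j : ℝ) ≤
        ((pivots C (peel C A j')).filter fun i => i ≤ k ∧ c i ≠ 0).card := by
      intro j' hj'
      have := hmin j' hj'
      simp only [v, T, filter_filter] at this ⊢
      exact_mod_cast this
    simpa using card_nsmul_le_sum _ _ _ h2
  rw [← hX]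
  by_cases hu : u = 0
  · have : X ⟨(k, j), u⟩ = ∅ := by
      rw [hX, filter_eq_empty_iff]
      rintro i hi ⟨hik, hci⟩
      refine hci (hdet c hc (fun i hi => ?_) i hi hik)
      simpa [u, hi] using congrFun hu i
    rw [this, sum_empty, abs_zero]
    positivity
  · have hmem : (⟨(k, j), u⟩ : Σ _ : ι × ℕ, ι → G) ∈ J := by
      simp only [J, U, mem_sigma, mem_product, mem_erase, Fintype.mem_piFinset]
      refine ⟨⟨hk, hj⟩, hu, fun i => ?_⟩
      by_cases hi : i ∈ T (k, j) <;> simp [u, hi]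
    refine (hbal _ hmem).trans ?_
    have hle : ((X ⟨(k, j), u⟩).card : ℝ) ≤ (A.filter fun i => i ≤ k ∧ c i ≠ 0).card :=
      le_trans (le_add_of_nonneg_left (by positivity)) hcount
    simp only [τ, hsu]
    have hpos : (0 : ℝ) ≤ (A.filter fun i => i ≤ k ∧ c i ≠ 0).card := by positivity
    nlinarith

/-- Summation by parts: if `w` is nonincreasing and the initial sums of `a` are nonnegative, then
the `w`-weighted sum of `a` is nonnegative. -/
theorem sum_mul_nonneg_of_antitoneOn {ι : Type*} [LinearOrder ι] (A : Finset ι) {w a : ι → ℝ}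
    (hw : AntitoneOn w A) (hw0 : ∀ i ∈ A, 0 ≤ w i)
    (h : ∀ k ∈ A, 0 ≤ ∑ i ∈ A with i ≤ k, a i) : 0 ≤ ∑ i ∈ A, w i * a i := by
  suffices H : ∀ θ : ℝ, 0 ≤ θ → (∀ i ∈ A, θ ≤ w i) → θ * ∑ i ∈ A, a i ≤ ∑ i ∈ A, w i * a i by
    simpa using H 0 le_rfl hw0
  induction A using Finset.induction_on_max with
  | empty => simp
  | insert k A hk ih =>
    intro θ hθ hθw
    have hkA : k ∉ A := fun hmem => lt_irrefl k (hk k hmem)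
    have hsum : 0 ≤ ∑ i ∈ insert k A, a i := by
      have := h k (mem_insert_self _ _)
      rwa [filter_true_of_mem] at this
      intro i hi
      rcases mem_insert.1 hi with rfl | hi
      exacts [le_rfl, (hk i hi).le]
    have hih := ih (hw.mono (by simp)) (fun i hi => hw0 i (mem_insert_of_mem hi))
      (fun j hj => by
        have := h j (mem_insert_of_mem hj)
        rwa [filter_insert, if_neg (not_le.2 (hk j hj))] at this)
      (w k) (hw0 k (mem_insert_self _ _))
      (fun i hi => hw (by simp [hi]) (by simp) (hk i hi).le)
    have := mul_le_mul_of_nonneg_right (hθw k (mem_insert_self _ _)) hsum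
    rw [sum_insert hkA] at this hsum ⊢
    rw [sum_insert hkA]
    linarith

/-- The weight of `c` when coordinate `i` counts `w i`. -/
noncomputable def weight {ι G : Type*} [Fintype ι] [Zero G] (w : ι → ℝ) (c : ι → G) : ℝ :=
  ∑ i, Set.indicator {j | c j ≠ 0} w i

theorem weight_nonneg {ι G : Type*} [Fintype ι] [Zero G] {w : ι → ℝ} (hw : ∀ i, 0 ≤ w i)
    (c : ι → G) : 0 ≤ weight w c :=
  sum_nonneg fun _ _ => Set.indicator_nonneg (fun i _ => hw i) _

theorem exists_sparser_of_antitone {ι G : Type*} [Fintype ι] [LinearOrder ι] [AddCommGroup G]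
    [Fintype G] (C : AddSubgroup (ι → G)) {w : ι → ℝ} (hw0 : ∀ i, 0 ≤ w i) (hw : Antitone w)
    {N d : ℕ} (hC : Nat.card C ≤ 2 ^ N) (hd : 1 ≤ d) {ε : ℝ} (hε : 0 < ε)
    (h : 2 * (Function.support w).ncard * d *
      ((1 + Fintype.card G * Real.exp (-ε ^ 2 * d / 2)) ^ N - 1) < 1) :
    ∃ w' : ι → ℝ, (∀ i, 0 ≤ w' i) ∧
      ((Function.support w').ncard : ℝ) ≤ d * N + (Function.support w).ncard / 2 ∧
      ∀ c ∈ C, |weight w' c - weight w c| ≤ ε * weight w c := by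
  classical
  set A : Finset ι := univ.filter fun i => w i ≠ 0 with hA
  have hAs : (A : Set ι) = Function.support w := by ext; simp [hA]
  rw [← hAs, Set.ncard_coe_finset] at h ⊢
  obtain ⟨σ, hσ, hbal, hhalf⟩ : ∃ σ : ι → ℝ, (∀ i, σ i = 1 ∨ σ i = -1) ∧
      (∀ c ∈ C, ∀ k ∈ A, |∑ i ∈ peel C A d with i ≤ k ∧ c i ≠ 0, σ i| ≤
        ε * (A.filter fun i => i ≤ k ∧ c i ≠ 0).card) ∧
      2 * (((peel C A d).filter fun i => σ i = 1).card : ℝ) ≤ (peel C A d).card := by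
    obtain ⟨σ, hσ, hbal⟩ := exists_signs_peel C A hC hd hε h
    have hsplit := card_filter_add_card_filter_not (s := peel C A d) (fun i => σ i = 1)
    by_cases hle : 2 * ((peel C A d).filter fun i => σ i = 1).card ≤ (peel C A d).card
    · exact ⟨σ, hσ, hbal, by exact_mod_cast hle⟩
    · refine ⟨-σ, fun i => ?_, fun c hc k hk => ?_, ?_⟩
      · rcases hσ i with h | h <;> simp [h]
      · simpa [sum_neg_distrib] using hbal c hc k hk
      · have h1 : ((peel C A d).filter fun i => (-σ) i = 1) =
            (peel C A d).filter fun i => ¬ σ i = 1 := by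
          refine filter_congr fun i _ => ?_
          rcases hσ i with h | h <;> simp [h] <;> norm_num
        rw [h1]
        exact_mod_cast (by omega :
          2 * ((peel C A d).filter fun i => ¬ σ i = 1).card ≤ (peel C A d).card)
  set R := peel C A d with hR
  have hRA : R ⊆ A := peel_subset_of_le C A (Nat.zero_le d)
  refine ⟨fun i => if i ∈ R then (1 + σ i) * w i else w i, fun i => ?_, ?_, fun c hc => ?_⟩
  · dsimp only
    split_ifs
    · rcases hσ i with h | h <;> simp [h, hw0 i]
    · exact hw0 i
  · have hsub : Function.support (fun i => if i ∈ R then (1 + σ i) * w i else w i) ⊆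
        ((A \ R ∪ R.filter fun i => σ i = 1 : Finset ι) : Set ι) := by
      intro i hi
      by_cases hiR : i ∈ R
      · rcases hσ i with h | h
        · simp [hiR, h]
        · simp [hiR, h] at hi
      · simp only [Function.mem_support, hiR, if_false] at hi
        simp [hiR, hA, hi]
    have h1 : (Function.support fun i => if i ∈ R then (1 + σ i) * w i else w i).ncard ≤
        (A \ R).card + (R.filter fun i => σ i = 1).card := by
      refine (Set.ncard_le_ncard hsub (finite_toSet _)).trans ?_
      rw [Set.ncard_coe_finset]
      exact card_union_le _ _
    have h2 : (A.card : ℝ) ≤ d * N + R.card := by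
      have := sum_eq_sum_pivots_add_sum_peel C A (fun _ => 1) d
      simp only [sum_const, nsmul_eq_mul, mul_one] at this
      rw [this]
      refine add_le_add_left ?_ _
      refine (sum_le_card_nsmul _ _ (N : ℝ) fun j _ => ?_).trans (by simp)
      exact_mod_cast (Nat.pow_le_pow_iff_right one_lt_two).1
        ((two_pow_card_pivots_le _ _).trans hC)
    have h3 := card_sdiff_add_card_eq_card hRA
    have h1' : ((Function.support fun i => if i ∈ R then (1 + σ i) * w i else w i).ncard : ℝ) ≤
        (A \ R).card + (R.filter fun i => σ i = 1).card := by exact_mod_cast h1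
    have h3' : ((A \ R).card + R.card : ℝ) = A.card := by exact_mod_cast h3
    linarith
  · have hW : weight w c = ∑ i ∈ A, w i * (if c i ≠ 0 then 1 else 0) := by
      rw [weight, hA, sum_filter]
      refine sum_congr rfl fun i _ => ?_
      by_cases h1 : c i = 0 <;> by_cases h2 : w i = 0 <;> simp [h1, h2]
    have hdiff : weight (fun i => if i ∈ R then (1 + σ i) * w i else w i) c - weight w c =
        ∑ i ∈ A, w i * (if i ∈ R ∧ c i ≠ 0 then σ i else 0) := by
      rw [weight, weight, ← sum_sub_distrib, hA, sum_filter]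
      refine sum_congr rfl fun i _ => ?_
      by_cases h1 : c i = 0 <;> by_cases h2 : w i = 0 <;> by_cases h3 : i ∈ R <;>
        simp [h1, h2, h3]
      ring
    have hpre : ∀ k, ∑ i ∈ A with i ≤ k, (if i ∈ R ∧ c i ≠ 0 then σ i else 0) =
        ∑ i ∈ R with i ≤ k ∧ c i ≠ 0, σ i := by
      intro k
      rw [← sum_filter, filter_filter]
      refine sum_congr ?_ fun _ _ => rfl
      ext i
      simp only [mem_filter]
      exact ⟨fun h => ⟨h.2.2.1, h.2.1, h.2.2.2⟩, fun h => ⟨hRA h.1, h.2.1, h.1, h.2.2⟩⟩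
    have hpre' : ∀ k, ∑ i ∈ A with i ≤ k, (if c i ≠ 0 then (1 : ℝ) else 0) =
        (A.filter fun i => i ≤ k ∧ c i ≠ 0).card := by
      intro k
      rw [sum_boole, filter_filter]
    rw [hdiff, hW, mul_sum, abs_le, ← sub_nonneg, ← sub_nonneg (b := ∑ i ∈ A, w i * _)]
    rw [sub_neg_eq_add, ← sum_add_distrib, ← sum_sub_distrib]
    have e1 := sum_mul_nonneg_of_antitoneOn A
      (a := fun i => (if i ∈ R ∧ c i ≠ 0 then σ i else 0) + ε * (if c i ≠ 0 then 1 else 0))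
      (hw.antitoneOn _) (fun i _ => hw0 i) (fun k hk => by
        rw [sum_add_distrib, ← mul_sum, hpre, hpre']
        linarith [(abs_le.1 (hbal c hc k hk)).1])
    have e2 := sum_mul_nonneg_of_antitoneOn A
      (a := fun i => ε * (if c i ≠ 0 then 1 else 0) - (if i ∈ R ∧ c i ≠ 0 then σ i else 0))
      (hw.antitoneOn _) (fun i _ => hw0 i) (fun k hk => by
        rw [sum_sub_distrib, ← mul_sum, hpre, hpre']
        linarith [(abs_le.1 (hbal c hc k hk)).2])
    simp only [mul_add, mul_sub, mul_left_comm] at e1 e2 ⊢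
    exact ⟨e1, e2⟩

/-- The support of a weighted code can be roughly halved. -/
theorem exists_sparser {ι G : Type*} [Fintype ι] [AddCommGroup G]
    [Fintype G] (C : AddSubgroup (ι → G)) {w : ι → ℝ} (hw0 : ∀ i, 0 ≤ w i)
    {N d : ℕ} (hC : Nat.card C ≤ 2 ^ N) (hd : 1 ≤ d) {ε : ℝ} (hε : 0 < ε) {X : ℝ} (hX : 1 ≤ X)
    (hwX : (Function.support w).ncard ≤ X)
    (h : 8 * X * d * (Fintype.card G * N * Real.exp (-ε ^ 2 * d / 2)) ≤ 1) :
    ∃ w' : ι → ℝ, (∀ i, 0 ≤ w' i) ∧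
      ((Function.support w').ncard : ℝ) ≤ d * N + X / 2 ∧
      ∀ c ∈ C, |weight w' c - weight w c| ≤ ε * weight w c := by
  let f : ι → ℝ ×ₗ Fin (Fintype.card ι) := fun i => toLex (-w i, Fintype.equivFin ι i)
  have hf : Function.Injective f := fun i j hij => by
    have : ((-w i, Fintype.equivFin ι i) : ℝ × Fin (Fintype.card ι)) =
      (-w j, Fintype.equivFin ι j) := toLex.injective hij
    exact (Fintype.equivFin ι).injective (Prod.ext_iff.1 this).2
  let _ : LinearOrder ι := LinearOrder.lift' f hf
  have hw : Antitone w := fun i j hij => by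
    have h1 : f i ≤ f j := hij
    rcases Prod.Lex.le_iff.1 h1 with h2 | h2
    · exact (neg_lt_neg_iff.1 h2).le
    · exact (neg_injective h2.1).ge
  obtain ⟨w', h1, h2, h3⟩ := exists_sparser_of_antitone C hw0 hw hC hd hε (by
    set t := Real.exp (-ε ^ 2 * d / 2)
    have ht : 0 ≤ t := (Real.exp_pos _).le
    set y : ℝ := Fintype.card G * N * t with hy
    have hy0 : 0 ≤ y := by positivity
    have hd' : (1 : ℝ) ≤ d := by exact_mod_cast hd
    have hXd : 1 ≤ X * d := one_le_mul_of_one_le_of_one_le hX hd'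
    have hy1 : y ≤ 1 := by nlinarith
    have hpow : (1 + Fintype.card G * t) ^ N - 1 ≤ 2 * y := by
      have e1 : (1 + Fintype.card G * t) ^ N ≤ Real.exp y := by
        rw [hy, show Fintype.card G * N * t = N * (Fintype.card G * t) by ring, Real.exp_nat_mul]
        refine pow_le_pow_left₀ (by positivity) ?_ _
        linarith [Real.add_one_le_exp (Fintype.card G * t)]
      have e2 := Real.abs_exp_sub_one_le (x := y) (by rwa [abs_of_nonneg hy0])
      rw [abs_of_nonneg hy0] at e2
      linarith [le_abs_self (Real.exp y - 1)]
    calc _ ≤ 2 * X * d * (2 * y) := by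
          refine mul_le_mul (by gcongr) hpow (sub_nonneg.2 (one_le_pow₀ ?_)) (by positivity)
          exact le_add_of_nonneg_right (by positivity)
      _ < 1 := by nlinarith)
  exact ⟨w', h1, h2.trans (by linarith), h3⟩

theorem exists_peel_depth {N : ℕ} (hN : 1 ≤ N) {ε q M : ℝ} (hε0 : 0 < ε) (hε1 : ε < 1)
    (hq : 1 ≤ q) (hM : 1 ≤ M) (h : 16020 * N * Real.log (12 * q * M ^ 2) / ε ^ 2 ≤ M) (t : ℕ) :
    ∃ d : ℕ, 1 ≤ d ∧ d * N + M * (3 / 2) ^ (t + 1) / 2 ≤ M * (3 / 2) ^ t ∧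
      8 * (M * (3 / 2) ^ (t + 1)) * d *
        (q * N * Real.exp (-(ε * (9 / 10) ^ t / 20) ^ 2 * d / 2)) ≤ 1 := by
  set L := Real.log (12 * q * M ^ 2) with hLdef
  have hM2 : 1 ≤ M ^ 2 := one_le_pow₀ hM
  have hqM : 1 ≤ q * M ^ 2 := one_le_mul_of_one_le_of_one_le hq hM2
  have hL : 1 ≤ L := by
    rw [hLdef, Real.le_log_iff_exp_le (by positivity)]
    linarith [Real.exp_one_lt_d9]
  have hN' : (1 : ℝ) ≤ N := by exact_mod_cast hN
  have ht0 : (0 : ℝ) ≤ t := Nat.cast_nonneg t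
  have hε2 : ε ^ 2 ≤ 1 := pow_le_one₀ hε0.le hε1.le
  set P : ℝ := (100 / 81) ^ t / ε ^ 2 with hP
  have hP1 : 1 ≤ P := by
    rw [hP, one_le_div (by positivity)]
    exact hε2.trans (one_le_pow₀ (by norm_num))
  set D : ℝ := 800 * (P * (L + t)) with hD
  have hPL : 1 ≤ P * (L + t) := one_le_mul_of_one_le_of_one_le hP1 (by linarith)
  have hdD : D ≤ ⌈D⌉₊ := Nat.le_ceil D
  have hdlt : (⌈D⌉₊ : ℝ) < D + 1 := Nat.ceil_lt_add_one (by positivity)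
  have hdN : (⌈D⌉₊ : ℝ) * N ≤ M * (3 / 2) ^ t / 4 := by
    have hbern : (1 + t : ℝ) ≤ 5 * (6 / 5) ^ t := by
      have := one_add_mul_le_pow (a := (1 / 5 : ℝ)) (by norm_num) t
      norm_num at this ⊢
      linarith
    have hpow : (100 / 81 : ℝ) ^ t * (6 / 5) ^ t ≤ (3 / 2) ^ t := by
      rw [← mul_pow]
      exact pow_le_pow_left₀ (by norm_num) (by norm_num) _
    calc (⌈D⌉₊ : ℝ) * N ≤ 801 * (P * (L + t)) * N := by gcongr; linarith
      _ ≤ 801 * (P * (L * (1 + t))) * N := by gcongr; nlinarith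
      _ = (16020 * N * L / ε ^ 2) / 20 * ((100 / 81) ^ t * (1 + t)) := by rw [hP]; ring
      _ ≤ M / 20 * ((100 / 81) ^ t * (5 * (6 / 5) ^ t)) := by gcongr
      _ = M / 4 * ((100 / 81) ^ t * (6 / 5) ^ t) := by ring
      _ ≤ M / 4 * (3 / 2) ^ t := by gcongr
      _ = _ := by ring
  refine ⟨⌈D⌉₊, Nat.one_le_ceil_iff.2 (by positivity), ?_, ?_⟩
  · rw [pow_succ]
    linarith
  · have hexp : Real.exp (-(ε * (9 / 10) ^ t / 20) ^ 2 * ⌈D⌉₊ / 2) ≤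
        Real.exp (-t) / (12 * q * M ^ 2) := by
      rw [← Real.exp_log (show 0 < 12 * q * M ^ 2 by positivity), ← Real.exp_sub,
        Real.exp_le_exp, ← hLdef]
      have h1 : (ε * (9 / 10) ^ t / 20) ^ 2 * D = 2 * (L + t) := by
        have h2 : (9 / 10 : ℝ) ^ t * (9 / 10) ^ t * (100 / 81) ^ t = 1 := by
          rw [← mul_pow, ← mul_pow]
          norm_num
        rw [hD, hP]
        field_simp
        linear_combination 800 * h2
      have h3 := mul_le_mul_of_nonneg_left hdD (sq_nonneg (ε * (9 / 10) ^ t / 20))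
      linarith
    have hpe : ((3 / 2 : ℝ) ^ t) * (3 / 2) ^ t * Real.exp (-t) ≤ 1 := by
      have h1 : Real.exp (-t) = Real.exp (-1) ^ t := by
        rw [← Real.exp_nat_mul]
        ring_nf
      rw [h1, ← mul_pow, ← mul_pow]
      refine pow_le_one₀ (by positivity) ?_
      rw [Real.exp_neg, ← div_eq_mul_inv, div_le_one (Real.exp_pos _)]
      linarith [Real.exp_one_gt_d9]
    calc _ = 8 * (M * (3 / 2) ^ (t + 1)) * (⌈D⌉₊ * N) *
          (q * Real.exp (-(ε * (9 / 10) ^ t / 20) ^ 2 * ⌈D⌉₊ / 2)) := by ring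
      _ ≤ 8 * (M * (3 / 2) ^ (t + 1)) * (M * (3 / 2) ^ t / 4) *
          (q * (Real.exp (-t) / (12 * q * M ^ 2))) := by gcongr
      _ = (3 / 2) ^ t * (3 / 2) ^ t * Real.exp (-t) / 4 := by
          field_simp
          ring
      _ ≤ 1 := by linarith

/-- Iterating `exists_sparser` with geometrically decreasing error. -/
theorem exists_sparsifier {ι G : Type*} [Fintype ι] [AddCommGroup G] [Fintype G]
    (C : AddSubgroup (ι → G)) {N : ℕ} (hN : 1 ≤ N) (hC : Nat.card C ≤ 2 ^ N) {ε M : ℝ}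
    (hε0 : 0 < ε) (hε1 : ε < 1) (hM : 1 ≤ M)
    (h : 16020 * N * Real.log (12 * Fintype.card G * M ^ 2) / ε ^ 2 ≤ M) (t : ℕ) :
    ∀ w : ι → ℝ, (∀ i, 0 ≤ w i) → (Function.support w).ncard ≤ M * (3 / 2) ^ t →
      ∃ w' : ι → ℝ, (∀ i, 0 ≤ w' i) ∧ (Function.support w').ncard ≤ M ∧
        ∀ c ∈ C, |weight w' c - weight w c| ≤ ε * (1 - (9 / 10) ^ t) * weight w c := by
  have hq : (1 : ℝ) ≤ Fintype.card G := by exact_mod_cast Fintype.card_pos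
  induction t with
  | zero =>
    intro w hw0 hw
    exact ⟨w, hw0, by simpa using hw, by simp⟩
  | succ t ih =>
    intro w hw0 hw
    obtain ⟨d, hd, hsize, herr⟩ := exists_peel_depth hN hε0 hε1 hq hM h t
    obtain ⟨w₁, hw₁0, hw₁, hw₁C⟩ := exists_sparser C hw0 hC hd
      (ε := ε * (9 / 10) ^ t / 20) (by positivity)
      (one_le_mul_of_one_le_of_one_le hM (one_le_pow₀ (by norm_num))) hw herr
    obtain ⟨w', hw'0, hw', hw'C⟩ := ih w₁ hw₁0 (hw₁.trans hsize)
    refine ⟨w', hw'0, hw', fun c hc => ?_⟩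
    have e1 := hw₁C c hc
    have e2 := hw'C c hc
    have hW := weight_nonneg hw0 c
    set ρ : ℝ := (9 / 10) ^ t with hρ
    have hρ0 : 0 < ρ := by positivity
    have hρ1 : ρ ≤ 1 := pow_le_one₀ (by norm_num) (by norm_num)
    have ha0 : 0 ≤ ε * (1 - ρ) := mul_nonneg hε0.le (by linarith)
    have ha1 : ε * (1 - ρ) ≤ 1 := by nlinarith
    have e3 : weight w₁ c ≤ (1 + ε * ρ / 20) * weight w c := by linarith [(abs_le.1 e1).2]
    have hb : 0 ≤ ε * ρ / 20 * weight w c := by positivity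
    calc |weight w' c - weight w c|
        ≤ |weight w' c - weight w₁ c| + |weight w₁ c - weight w c| := abs_sub_le _ _ _
      _ ≤ ε * (1 - ρ) * ((1 + ε * ρ / 20) * weight w c) + ε * ρ / 20 * weight w c :=
          add_le_add (e2.trans (mul_le_mul_of_nonneg_left e3 ha0)) e1
      _ ≤ ε * (1 - ρ) * weight w c + 2 * (ε * ρ / 20 * weight w c) := by
          nlinarith [mul_le_mul_of_nonneg_right ha1 hb]
      _ = ε * (1 - (9 / 10) ^ (t + 1)) * weight w c := by
          rw [pow_succ, ← hρ]
          ring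

theorem log_size_le {q n N : ℕ} (hq : 2 ≤ q) (hn : 1 ≤ n) (hN : N ≤ n * q) {ε : ℝ}
    (hε0 : 0 < ε) (hε1 : ε < 1) :
    Real.log (12 * q * (2 ^ 20 * N * Real.logb 2 (2 * n * q / ε) / ε ^ 2) ^ 2) ≤
      33 * Real.logb 2 (2 * n * q / ε) := by
  set y : ℝ := 2 * n * q / ε with hy
  set l := Real.logb 2 y with hl
  have hq' : (2 : ℝ) ≤ q := by exact_mod_cast hq
  have hn' : (1 : ℝ) ≤ n := by exact_mod_cast hn
  have hN' : (N : ℝ) ≤ n * q := by exact_mod_cast hN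
  have hnq : (2 : ℝ) ≤ n * q := by nlinarith
  have hinv : 1 ≤ 1 / ε := by rw [one_le_div hε0]; exact hε1.le
  have hyeq : y = 2 * (n * q) * (1 / ε) := by rw [hy]; ring
  have hyq : 2 * (n * q) ≤ y := by
    rw [hyeq]
    exact le_mul_of_one_le_right (by positivity) hinv
  have hy4 : 4 ≤ y := by linarith
  have hyε : 1 / ε ≤ y := by
    rw [hyeq]
    exact le_mul_of_one_le_left (by positivity) (by linarith)
  have hqy : (q : ℝ) ≤ y := by nlinarith
  have hNy : (N : ℝ) ≤ y := by linarith
  have hlogy : 0 ≤ Real.log y := Real.log_nonneg (by linarith)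
  have hlog : Real.log y = l * Real.log 2 := by
    rw [hl, Real.logb, div_mul_cancel₀ _ (Real.log_pos one_lt_two).ne']
  have hl0 : 0 ≤ l := Real.logb_nonneg one_lt_two (by linarith)
  have hly : l ≤ y ^ 2 := by
    have := Real.log_le_sub_one_of_pos (show 0 < y by linarith)
    nlinarith [Real.log_two_gt_d9]
  have hloglel : Real.log y ≤ l := by
    rw [hlog]
    exact mul_le_of_le_one_right hl0 (by linarith [Real.log_two_lt_d9])
  have h20 : (2 : ℝ) ^ 20 ≤ y ^ 10 := by
    calc (2 : ℝ) ^ 20 = 4 ^ 10 := by norm_num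
      _ ≤ y ^ 10 := by gcongr
  have hM : 2 ^ 20 * N * l / ε ^ 2 ≤ y ^ 15 := by
    calc 2 ^ 20 * N * l / ε ^ 2 = 2 ^ 20 * N * l * (1 / ε) ^ 2 := by ring
      _ ≤ y ^ 10 * y * y ^ 2 * y ^ 2 := by gcongr
      _ = y ^ 15 := by ring
  have hM0 : 0 ≤ 2 ^ 20 * N * l / ε ^ 2 := by positivity
  have htot : 12 * q * (2 ^ 20 * N * l / ε ^ 2) ^ 2 ≤ y ^ 33 := by
    calc 12 * q * (2 ^ 20 * N * l / ε ^ 2) ^ 2 ≤ y ^ 2 * y * (y ^ 15) ^ 2 := by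
          gcongr
          nlinarith
      _ = y ^ 33 := by ring
  rcases (show 0 ≤ 12 * q * (2 ^ 20 * N * l / ε ^ 2) ^ 2 by positivity).eq_or_lt with h0 | h0
  · rw [← h0, Real.log_zero]
    positivity
  · calc _ ≤ Real.log (y ^ 33) := Real.log_le_log h0 htot
      _ = 33 * Real.log y := by rw [Real.log_pow]; norm_num
      _ ≤ 33 * l := by linarith

end CodeSparsifier

/-- Existence of near-linear size (1±ε) code-sparsifiers for codes over ℤ_q. -/
theorem stmt_2 :
    ∃ K c : ℝ, 0 < K ∧ 0 < c ∧
      ∀ (q n m : ℕ), 2 ≤ q → 1 ≤ n → 1 ≤ m → m ≤ q ^ n →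
      ∀ ε : ℝ, 0 < ε → ε < 1 →
      ∀ C : AddSubgroup (Fin m → ZMod q), Nat.card C ≤ q ^ n →
      ∃ (S : Finset (Fin m)) (w : Fin m → ℝ),
        (∀ i ∈ S, 0 ≤ w i) ∧
        (S.card : ℝ) ≤ K * n * (Real.logb 2 (2 * (q : ℝ))) ^ 2 *
          (Real.logb 2 (2 * (n : ℝ) * (q : ℝ) / ε)) ^ c / ε ^ 2 ∧
        ∀ x ∈ C,
          (1 - ε) * (Nat.card {i : Fin m // x i ≠ 0} : ℝ) ≤
              ∑ i ∈ S, Set.indicator {j : Fin m | x j ≠ 0} w i ∧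
            ∑ i ∈ S, Set.indicator {j : Fin m | x j ≠ 0} w i ≤
              (1 + ε) * (Nat.card {i : Fin m // x i ≠ 0} : ℝ) := by
  refine ⟨2 ^ 20, 1, by positivity, one_pos, ?_⟩
  intro q n m hq hn _ _ ε hε0 hε1 C hC
  have : NeZero q := ⟨by omega⟩
  set l := Real.logb 2 (2 * (n : ℝ) * (q : ℝ) / ε) with hl
  set g := Real.logb 2 (2 * (q : ℝ)) with hg
  have hq' : (2 : ℝ) ≤ q := by exact_mod_cast hq
  have hn' : (1 : ℝ) ≤ n := by exact_mod_cast hn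
  have hclog : 1 ≤ Nat.clog 2 q := Nat.clog_pos one_lt_two hq
  set N := n * Nat.clog 2 q with hNdef
  have hN : 1 ≤ N := Nat.mul_pos hn hclog
  have hCN : Nat.card C ≤ 2 ^ N := by
    rw [hNdef, mul_comm, pow_mul]
    exact hC.trans (Nat.pow_le_pow_left (Nat.le_pow_clog one_lt_two q) n)
  have hNq : N ≤ n * q :=
    Nat.mul_le_mul_left n (Nat.clog_le_of_le_pow Nat.lt_two_pow_self.le)
  have hNg : (N : ℝ) ≤ n * g := by
    have h1 : ((Nat.clog 2 q - 1 : ℕ) : ℝ) ≤ Real.logb 2 q := by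
      rw [Real.le_logb_iff_rpow_le one_lt_two (by positivity), Real.rpow_natCast]
      exact_mod_cast (Nat.pow_pred_clog_lt_self one_lt_two hq).le
    rw [Nat.cast_sub hclog, Nat.cast_one] at h1
    have h2 : g = 1 + Real.logb 2 q := by
      rw [hg, Real.logb_mul two_ne_zero (by positivity), Real.logb_self_eq_one one_lt_two]
    rw [hNdef, Nat.cast_mul]
    gcongr
    linarith
  have hg1 : 1 ≤ g := by
    rw [hg, Real.le_logb_iff_rpow_le one_lt_two (by positivity), Real.rpow_one]
    linarith
  have hl1 : 1 ≤ l := by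
    rw [hl, Real.le_logb_iff_rpow_le one_lt_two (by positivity), Real.rpow_one,
      le_div_iff₀ hε0]
    nlinarith
  have hN' : (1 : ℝ) ≤ N := by exact_mod_cast hN
  set M : ℝ := 2 ^ 20 * N * l / ε ^ 2 with hM
  have hM1 : 1 ≤ M := by
    rw [hM, one_le_div (by positivity)]
    have := one_le_mul_of_one_le_of_one_le hN' hl1
    have : ε ^ 2 ≤ 1 := pow_le_one₀ hε0.le hε1.le
    linarith
  have hlog : 16020 * N * Real.log (12 * Fintype.card (ZMod q) * M ^ 2) / ε ^ 2 ≤ M := by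
    rw [ZMod.card, hM]
    have h1 := CodeSparsifier.log_size_le hq hn hNq hε0 hε1
    rw [← hl] at h1
    refine div_le_div_of_nonneg_right ?_ (by positivity)
    calc _ ≤ 16020 * N * (33 * l) := by gcongr
      _ ≤ 2 ^ 20 * N * l := by nlinarith
  obtain ⟨t, ht⟩ := pow_unbounded_of_one_lt (m : ℝ) (show (1 : ℝ) < 3 / 2 by norm_num)
  obtain ⟨w, hw0, hwM, hw⟩ := CodeSparsifier.exists_sparsifier C hN hCN hε0 hε1 hM1 hlog t
    (fun _ => 1) (fun _ => zero_le_one) (by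
      have h1 : (Function.support fun _ : Fin m => (1 : ℝ)).ncard ≤ m := by
        simpa using Set.ncard_le_card (Function.support fun _ : Fin m => (1 : ℝ))
      calc _ ≤ (m : ℝ) := by exact_mod_cast h1
        _ ≤ 1 * (3 / 2) ^ t := by linarith
        _ ≤ M * (3 / 2) ^ t := by gcongr)
  refine ⟨Finset.univ.filter fun i => w i ≠ 0, w, fun i _ => hw0 i, ?_, fun x hx => ?_⟩
  · have h1 : (Function.support w).ncard = (Finset.univ.filter fun i => w i ≠ 0).card := by
      rw [← Set.ncard_coe_finset]
      congr 1
      ext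
      simp
    rw [← h1, Real.rpow_one]
    refine hwM.trans ?_
    rw [hM]
    refine div_le_div_of_nonneg_right ?_ (by positivity)
    have h2 : (N : ℝ) ≤ n * g ^ 2 := hNg.trans (by gcongr; nlinarith)
    calc 2 ^ 20 * N * l ≤ 2 ^ 20 * (n * g ^ 2) * l := by gcongr
      _ = _ := by ring
  · have h1 : CodeSparsifier.weight (fun _ => 1) x = (Nat.card {i : Fin m // x i ≠ 0} : ℝ) := by
      classical
      simp only [CodeSparsifier.weight, Set.indicator_apply, Set.mem_ofPred_eq, Finset.sum_boole,
        Nat.card_eq_fintype_card, Fintype.card_subtype]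
    have h2 : ∑ i ∈ Finset.univ.filter fun i => w i ≠ 0, Set.indicator {j : Fin m | x j ≠ 0} w i =
        CodeSparsifier.weight w x := by
      rw [CodeSparsifier.weight, Finset.sum_filter]
      refine Finset.sum_congr rfl fun i _ => ?_
      by_cases h : w i = 0 <;> simp [h, Set.indicator_apply]
    have h3 := hw x hx
    rw [h2, ← h1]
    have hW := CodeSparsifier.weight_nonneg (w := fun _ => (1 : ℝ)) (fun _ => zero_le_one) x
    have h4 : ε * (1 - (9 / 10) ^ t) ≤ ε :=
      mul_le_of_le_one_right hε0.le (sub_le_self _ (by positivity))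
    obtain ⟨h5, h6⟩ := abs_le.1 (h3.trans (mul_le_mul_of_nonneg_right h4 hW))
    constructor <;> linarith
end

section
/- There exist absolute constants K > 0 and c > 0 such that the following holds. For every finite additive Abelian group G with q := |G| ≥ 2, all positive integers n, m with m ≤ q^n, every ε ∈ (0,1), and every additive subgroup 𝒞 of G^m with |𝒞| ≤ q^n, there exist a subset S ⊆ [m] with |S| ≤ K·n·(log₂(2q))²·(log₂(2nq/ε))^c / ε² and nonnegative real weights w : S → ℝ such that for every c ∈ 𝒞, (1−ε)·wt(c) ≤ Σ_{i ∈ S with c_i ≠ 0} w(i) ≤ (1+ε)·wt(c). -/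
open Finset

set_option linter.unusedSectionVars false

section
open scoped Classical
variable {ι : Type*} [Fintype ι]

/-- The probability of the set `S` when each `i` is selected independently with probability
`p i`. -/
noncomputable def setProb (p : ι → ℝ) (S : Finset ι) : ℝ := (∏ i ∈ S, p i) * ∏ i ∈ Sᶜ, (1 - p i)

lemma sum_setProb_mul_prod (p u v : ι → ℝ) :
    ∑ S : Finset ι, setProb p S * ∏ i, (if i ∈ S then u i else v i) =
      ∏ i, (p i * u i + (1 - p i) * v i) := by
  rw [Fintype.prod_add]
  refine sum_congr rfl fun S _ ↦ ?_
  rw [prod_ite, filter_mem_eq_inter, univ_inter, setProb, prod_mul_distrib, prod_mul_distrib]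
  have : univ.filter (fun i ↦ i ∉ S) = Sᶜ := by ext; simp
  rw [this]
  ring

lemma sum_setProb (p : ι → ℝ) : ∑ S : Finset ι, setProb p S = 1 := by
  simpa using sum_setProb_mul_prod p 1 1

lemma setProb_nonneg {p : ι → ℝ} (h0 : ∀ i, 0 ≤ p i) (h1 : ∀ i, p i ≤ 1) (S : Finset ι) :
    0 ≤ setProb p S :=
  mul_nonneg (prod_nonneg fun i _ ↦ h0 i) (prod_nonneg fun i _ ↦ sub_nonneg.2 (h1 i))

lemma sum_setProb_exp_card_le {p : ι → ℝ} (h0 : ∀ i, 0 ≤ p i) :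
    ∑ S : Finset ι, setProb p S * Real.exp (#S) ≤ Real.exp (2 * ∑ i, p i) := by
  have h : ∀ S : Finset ι, Real.exp (#S) = ∏ i, (if i ∈ S then Real.exp 1 else 1) := by
    intro S
    rw [prod_ite, filter_mem_eq_inter, univ_inter]
    simp [← Real.exp_nat_mul]
  simp_rw [h]
  rw [sum_setProb_mul_prod p (fun _ ↦ Real.exp 1) (fun _ ↦ 1), mul_sum, Real.exp_sum]
  refine prod_le_prod (fun i _ ↦ ?_) fun i _ ↦ ?_
  · nlinarith [h0 i, Real.exp_one_gt_two]
  · have := Real.add_one_le_exp (2 * p i)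
    nlinarith [h0 i, Real.exp_one_lt_three]

/-- The centred, inverse-probability weighted mass that `S` gives to the coordinates in `T`. -/
noncomputable def deviation (p a : ι → ℝ) (T S : Finset ι) : ℝ :=
  ∑ i ∈ T, ((if i ∈ S then (p i)⁻¹ else 0) - 1) * a i

lemma sum_setProb_exp_deviation_le {a : ι → ℝ} (ha : ∀ i, 0 ≤ a i) {ρ : ℝ} (hρ : 0 < ρ)
    (T : Finset ι) {s : ℝ} (hs : |s| ≤ 1) :
    ∑ S : Finset ι, setProb (fun i ↦ min 1 (ρ * a i)) S *
        Real.exp (s * ρ * deviation (fun i ↦ min 1 (ρ * a i)) a T S) ≤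
      Real.exp (s ^ 2 * ρ * ∑ i ∈ T, a i) := by
  set p : ι → ℝ := fun i ↦ min 1 (ρ * a i) with hp
  have h : ∀ S : Finset ι, Real.exp (s * ρ * deviation p a T S) =
      ∏ i, (if i ∈ S then (if i ∈ T then Real.exp (s * ρ * (((p i)⁻¹ - 1) * a i)) else 1)
        else (if i ∈ T then Real.exp (s * ρ * ((0 - 1) * a i)) else 1)) := by
    intro S
    rw [deviation, mul_sum, Real.exp_sum, ← prod_filter_mul_prod_filter_not univ (· ∈ T)]
    rw [prod_eq_one (s := univ.filter (· ∉ T)), mul_one, filter_mem_eq_inter, univ_inter]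
    · refine prod_congr rfl fun i hi ↦ ?_
      split_ifs <;> rfl
    · intro i hi
      simp [(mem_filter.1 hi).2]
  simp_rw [h]
  rw [sum_setProb_mul_prod, mul_sum, Real.exp_sum]
  have e : ∏ i ∈ T, Real.exp (s ^ 2 * ρ * a i) =
      ∏ i, if i ∈ T then Real.exp (s ^ 2 * ρ * a i) else 1 := by
    simp
  rw [e]
  have hp0 : ∀ i, 0 ≤ p i := fun i ↦ le_min zero_le_one (mul_nonneg hρ.le (ha i))
  have hp1 : ∀ i, p i ≤ 1 := fun i ↦ min_le_left _ _
  refine prod_le_prod (fun i _ ↦ ?_) fun i _ ↦ ?_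
  · have := hp0 i
    have := sub_nonneg.2 (hp1 i)
    split_ifs <;> positivity
  · by_cases hi : i ∈ T
    swap
    · simp [hi]
    simp only [hi, if_true]
    rcases le_total 1 (ρ * a i) with h1 | h1
    · have : p i = 1 := min_eq_left h1
      simp only [this, inv_one, sub_self, zero_mul, mul_zero, Real.exp_zero]
      have : 0 ≤ s ^ 2 * ρ * a i := by have := ha i; positivity
      have := Real.one_le_exp this
      linarith
    · have hpi : p i = ρ * a i := min_eq_right h1
      rcases (ha i).eq_or_lt with h0 | h0
      · simp [← h0]
      have e1 : s * ρ * (((p i)⁻¹ - 1) * a i) = s + -(s * p i) := by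
        rw [hpi]; field_simp; ring
      have e2 : s * ρ * ((0 - 1) * a i) = -(s * p i) := by rw [hpi]; ring
      have e3 : s ^ 2 * ρ * a i = s ^ 2 * p i := by rw [hpi]; ring
      rw [e1, e2, e3, Real.exp_add]
      have hq := (abs_le.1 (Real.abs_exp_sub_one_sub_id_le hs)).2
      calc p i * (Real.exp s * Real.exp (-(s * p i))) + (1 - p i) * Real.exp (-(s * p i))
          = (p i * (Real.exp s - 1) + 1) * Real.exp (-(s * p i)) := by ring
        _ ≤ Real.exp (p i * (s + s ^ 2)) * Real.exp (-(s * p i)) := by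
            gcongr
            refine le_trans ?_ (Real.add_one_le_exp _)
            have := mul_le_mul_of_nonneg_left hq (hp0 i)
            linarith
        _ = _ := by rw [← Real.exp_add]; congr 1; ring

end

section
open scoped Classical
variable {V ι : Type*} [AddCommGroup V] [Finite V] [Fintype ι]

/-- The binary logarithm of the order of a subgroup. -/
noncomputable def lg {V : Type*} [AddCommGroup V] (A : AddSubgroup V) : ℝ :=
  Real.logb 2 (Nat.card A)

lemma card_eq_two_rpow_lg (A : AddSubgroup V) : (Nat.card A : ℝ) = 2 ^ lg A :=
  (Real.rpow_logb (by norm_num) (by norm_num) (by exact_mod_cast Nat.card_pos)).symm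

lemma lg_add_one_le {A B : AddSubgroup V} (h : A < B) : lg A + 1 ≤ lg B := by
  have h1 : Nat.card A ∣ Nat.card B := AddSubgroup.card_dvd_of_le h.le
  have h2 : Nat.card A ≠ Nat.card B := fun e ↦
    h.ne (AddSubgroup.eq_of_le_of_card_ge h.le e.ge)
  have hA : 0 < Nat.card A := Nat.card_pos
  have h3 : Nat.card A * 2 ≤ Nat.card B := by
    obtain ⟨k, hk⟩ := h1
    have hB : 0 < Nat.card B := Nat.card_pos
    rcases k with _ | _ | k
    · omega
    · omega
    · rw [hk]; gcongr; omega
  have h4 : lg A + 1 = Real.logb 2 (Nat.card A * 2) := by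
    rw [Real.logb_mul (by exact_mod_cast hA.ne') (by norm_num), Real.logb_self_eq_one (by norm_num)]
    rfl
  rw [h4]
  exact Real.logb_le_logb_of_le (by norm_num) (by positivity) (by exact_mod_cast h3)

lemma lg_mono {A B : AddSubgroup V} (h : A ≤ B) : lg A ≤ lg B := by
  rcases h.eq_or_lt with rfl | h
  · rfl
  · linarith [lg_add_one_le h]

lemma lg_sup_add_lg_inf (A B : AddSubgroup V) : lg (A ⊔ B) + lg (A ⊓ B) = lg A + lg B := by
  have hpos : ∀ D : AddSubgroup V, (Nat.card D : ℝ) ≠ 0 := fun D ↦ by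
    exact_mod_cast (Nat.card_pos (α := D)).ne'
  simp only [lg]
  rw [← Real.logb_mul (hpos _) (hpos _), ← Real.logb_mul (hpos _) (hpos _)]
  congr 1
  have h1 := AddSubgroup.relIndex_sup_right A B
  have h2 := AddSubgroup.relIndex_mul_relIndex ⊥ B (A ⊔ B) bot_le le_sup_right
  have h3 := AddSubgroup.relIndex_mul_relIndex ⊥ (A ⊓ B) A bot_le inf_le_left
  rw [AddSubgroup.inf_relIndex_left] at h3
  simp only [AddSubgroup.relIndex_bot_left] at h2 h3
  rw [← h2, ← h3, h1]
  push_cast; ring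

variable (H : ι → AddSubgroup V)

/-- If every subgroup `D ⊇ B` has weighted support at least `log₂ [D : B]`, then few elements have
weight at most `α`. -/
lemma card_weight_le (a : ι → ℝ) (ha : ∀ i, 0 ≤ a i) (I : Finset ι) (B : AddSubgroup V)
    (hB : ∀ i ∈ I, B ≤ H i)
    (hd : ∀ D, B ≤ D → lg D - lg B ≤ ∑ i ∈ I with ¬ D ≤ H i, a i) (α : ℕ) (hα : 1 ≤ α)
    (D : AddSubgroup V) (hD : B ≤ D) :
    (Nat.card {x : V // x ∈ D ∧ ∑ i ∈ I with x ∉ H i, a i ≤ α} : ℝ) ≤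
      Nat.card B * (4 ^ α * (lg D - lg B + 1) ^ (2 * α)) := by
  have := Fintype.ofFinite V
  induction D using WellFoundedLT.induction with
  | ind D ih =>
  set t := lg D - lg B with ht
  have ht0 : 0 ≤ t := by linarith [lg_mono hD]
  have hα' : (1 : ℝ) ≤ α := by exact_mod_cast hα
  rcases le_or_gt t (2 * α) with h | h
  · calc (Nat.card {x : V // x ∈ D ∧ ∑ i ∈ I with x ∉ H i, a i ≤ α} : ℝ) ≤ Nat.card D := by
          exact_mod_cast Nat.card_le_card_of_injective
            (fun x : {x : V // x ∈ D ∧ ∑ i ∈ I with x ∉ H i, a i ≤ α} ↦ (⟨x.1, x.2.1⟩ : D))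
            (fun x y hxy ↦ Subtype.ext (congrArg (fun z : D ↦ z.1) hxy))
      _ = Nat.card B * 2 ^ t := by
          rw [card_eq_two_rpow_lg, card_eq_two_rpow_lg, ← Real.rpow_add (by norm_num)]
          congr 1; rw [ht]; ring
      _ ≤ Nat.card B * (4 ^ α * 1) := by
          gcongr
          rw [mul_one, show (4 : ℝ) = 2 ^ (2 : ℝ) by norm_num, ← Real.rpow_natCast,
            ← Real.rpow_mul (by norm_num)]
          exact Real.rpow_le_rpow_of_exponent_le (by norm_num) h
      _ ≤ _ := by
          gcongr
          exact one_le_pow₀ (by linarith)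
  · set M : ℝ := Nat.card B * (4 ^ α * t ^ (2 * α)) with hM
    set s := ∑ i ∈ I with ¬ D ≤ H i, a i with hs
    have hts : t ≤ s := hd D hD
    have hM0 : 0 ≤ M := by positivity
    have hcard : ∀ D' : AddSubgroup V,
        (Nat.card {x : V // x ∈ D' ∧ ∑ i ∈ I with x ∉ H i, a i ≤ α} : ℝ) =
          ∑ x : V with x ∈ D' ∧ ∑ i ∈ I with x ∉ H i, a i ≤ α, 1 := by
      intro D'
      simp [Fintype.card_subtype]
    have h1 : ∀ i ∈ I.filter (fun i ↦ ¬ D ≤ H i),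
        ∑ x : V with x ∈ D ⊓ H i ∧ ∑ i ∈ I with x ∉ H i, a i ≤ α, (1 : ℝ) ≤ M := by
      intro i hi
      obtain ⟨hi, hDi⟩ := mem_filter.1 hi
      have hlt : D ⊓ H i < D := inf_le_left.lt_of_ne (fun e ↦ hDi (inf_eq_left.1 e))
      have := ih _ hlt (le_inf hD (hB i hi))
      rw [hcard] at this
      refine this.trans ?_
      have h2 := lg_add_one_le hlt
      have h3 := lg_mono (le_inf hD (hB i hi))
      rw [hM]
      gcongr
      linarith
    rw [hcard]
    set X := univ.filter (fun x : V ↦ x ∈ D ∧ ∑ i ∈ I with x ∉ H i, a i ≤ α) with hX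
    have h2 : (s - α) * ∑ x ∈ X, (1 : ℝ) ≤ s * M := by
      calc (s - α) * ∑ x ∈ X, (1 : ℝ)
          ≤ ∑ x ∈ X, ∑ i ∈ I with ¬ D ≤ H i, if x ∈ H i then a i else 0 := by
            rw [mul_sum]
            refine sum_le_sum fun x hx ↦ ?_
            have hx' := (mem_filter.1 hx).2
            have h3 : ∑ i ∈ I with x ∉ H i, a i =
                ∑ i ∈ I with ¬ D ≤ H i, if x ∈ H i then 0 else a i := by
              rw [sum_filter, sum_filter]
              refine sum_congr rfl fun i hi ↦ ?_
              by_cases h5 : x ∈ H i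
              · simp [h5]
              · have : ¬ D ≤ H i := fun h ↦ h5 (h hx'.1)
                simp [h5, this]
            have h4 : s = ∑ i ∈ I with ¬ D ≤ H i, (if x ∈ H i then a i else 0) +
                ∑ i ∈ I with ¬ D ≤ H i, if x ∈ H i then 0 else a i := by
              rw [← sum_add_distrib, hs]
              refine sum_congr rfl fun i hi ↦ ?_
              split_ifs <;> simp
            linarith [hx'.2]
        _ = ∑ i ∈ I with ¬ D ≤ H i, a i *
              ∑ x : V with x ∈ D ⊓ H i ∧ ∑ i ∈ I with x ∉ H i, a i ≤ α, (1 : ℝ) := by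
            rw [sum_comm]
            refine sum_congr rfl fun i hi ↦ ?_
            rw [mul_sum, ← sum_filter, hX, filter_filter]
            simp only [AddSubgroup.mem_inf, mul_one]
            refine sum_congr (filter_congr fun x _ ↦ by tauto) fun _ _ ↦ rfl
        _ ≤ ∑ i ∈ I with ¬ D ≤ H i, a i * M :=
            sum_le_sum fun i hi ↦ mul_le_mul_of_nonneg_left (h1 i hi) (ha i)
        _ = s * M := by rw [← sum_mul]
    have ht1 : 0 < t := by linarith
    set c := ∑ x ∈ X, (1 : ℝ) with hc
    have hc0 : 0 ≤ c := by positivity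
    have h3 : (t - α) * c ≤ t * M := by
      have h6 : 0 ≤ (s - t) * (α * c) := mul_nonneg (by linarith) (by positivity)
      have h7 : s * ((t - α) * c) ≤ s * (t * M) := by nlinarith
      exact le_of_mul_le_mul_left h7 (by linarith)
    have h5 : t * (t ^ (2 * α)) ≤ (t - α) * (t + 1) ^ (2 * α) := by
      have hb := one_add_mul_le_pow (a := 1 / t) (by have : 0 < 1 / t := by positivity
                                                     linarith) (2 * α)
      have e : (t + 1) ^ (2 * α) = t ^ (2 * α) * (1 + 1 / t) ^ (2 * α) := by
        rw [← mul_pow]; congr 1; field_simp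
      rw [e]
      have : t ≤ (t - α) * (1 + ((2 * α : ℕ) : ℝ) * (1 / t)) := by
        push_cast
        have : (t - α) * (1 + 2 * α * (1 / t)) = t + α * (t - 2 * α) / t := by
          field_simp; ring
        rw [this]
        have : 0 ≤ α * (t - 2 * α) / t := by
          apply div_nonneg _ ht1.le
          apply mul_nonneg <;> linarith
        linarith
      calc t * t ^ (2 * α) ≤ ((t - α) * (1 + ((2 * α : ℕ) : ℝ) * (1 / t))) * t ^ (2 * α) := by
            gcongr
        _ ≤ ((t - α) * (1 + 1 / t) ^ (2 * α)) * t ^ (2 * α) := by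
            gcongr
            linarith
        _ = _ := by ring
    have h8 : (t - α) * c ≤ (t - α) * (Nat.card B * (4 ^ α * (t + 1) ^ (2 * α))) := by
      refine h3.trans ?_
      calc t * M = Nat.card B * 4 ^ α * (t * t ^ (2 * α)) := by rw [hM]; ring
        _ ≤ Nat.card B * 4 ^ α * ((t - α) * (t + 1) ^ (2 * α)) := by gcongr
        _ = _ := by ring
    exact le_of_mul_le_mul_left h8 (by linarith)

/-- The total exponential weight of the elements outside `B` is a small multiple of the order
of `B`. -/
lemma sum_exp_neg_weight_le (a : ι → ℝ) (ha : ∀ i, 0 ≤ a i) (I : Finset ι) (B : AddSubgroup V)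
    (hB : ∀ i ∈ I, B ≤ H i)
    (hd : ∀ D, B ≤ D → lg D - lg B ≤ ∑ i ∈ I with ¬ D ≤ H i, a i)
    (N : ℝ) (hN : lg (⊤ : AddSubgroup V) - lg B ≤ N) (X : Finset V) (hX : ∀ x ∈ X, x ∉ B) :
    ∑ x ∈ X, Real.exp (-(Real.log (256 * (N + 1) ^ 5) * ∑ i ∈ I with x ∉ H i, a i)) ≤
      Nat.card B / (8 * (N + 1)) := by
  have := Fintype.ofFinite V
  have ht0 : 0 ≤ lg (⊤ : AddSubgroup V) - lg B := by linarith [lg_mono (le_top : B ≤ ⊤)]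
  have hN0 : 0 ≤ N := ht0.trans hN
  have hN1 : 1 ≤ N + 1 := by linarith
  have hL1 : (1 : ℝ) ≤ 256 * (N + 1) ^ 5 := by
    have := one_le_pow₀ hN1 (n := 5)
    linarith
  set L := Real.log (256 * (N + 1) ^ 5) with hL
  have hL0 : 0 ≤ L := Real.log_nonneg hL1
  set F : V → ℝ := fun x ↦ ∑ i ∈ I with x ∉ H i, a i with hF
  have hF0 : ∀ x, 0 ≤ F x := fun x ↦ sum_nonneg fun i _ ↦ ha i
  have hF1 : ∀ x ∈ X, 1 ≤ F x := by
    intro x hx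
    have hlt : B < B ⊔ AddSubgroup.zmultiples x := by
      refine le_sup_left.lt_of_ne fun e ↦ hX x hx ?_
      rw [e]
      exact le_sup_right (a := B) (AddSubgroup.mem_zmultiples x)
    have h1 := hd _ hlt.le
    have h2 := lg_add_one_le hlt
    have h3 : ∑ i ∈ I with ¬ B ⊔ AddSubgroup.zmultiples x ≤ H i, a i = F x := by
      refine sum_congr (filter_congr fun i hi ↦ ?_) fun _ _ ↦ rfl
      simp [hB i hi]
    linarith
  set M := ⌊∑ i ∈ I, a i⌋₊ with hM
  have hmaps : ∀ x ∈ X, ⌊F x⌋₊ ∈ Ico 1 (M + 1) := by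
    intro x hx
    rw [mem_Ico]
    refine ⟨Nat.le_floor (by exact_mod_cast hF1 x hx), Nat.lt_succ_of_le (Nat.floor_le_floor ?_)⟩
    exact sum_le_sum_of_subset_of_nonneg (filter_subset _ _) fun i _ _ ↦ ha i
  set η : ℝ := 1 / (16 * (N + 1)) with hη
  have hη0 : 0 ≤ η := by positivity
  have hη1 : η ≤ 1 / 2 := by
    rw [hη]
    apply one_div_le_one_div_of_le <;> linarith
  calc ∑ x ∈ X, Real.exp (-(L * F x))
      ≤ ∑ x ∈ X, Real.exp (-(L * ⌊F x⌋₊)) := by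
        refine sum_le_sum fun x hx ↦ Real.exp_le_exp.2 ?_
        have := mul_le_mul_of_nonneg_left (Nat.floor_le (hF0 x)) hL0
        linarith
    _ = ∑ k ∈ Ico 1 (M + 1), ∑ x ∈ X with ⌊F x⌋₊ = k, Real.exp (-(L * ⌊F x⌋₊)) :=
        (sum_fiberwise_of_maps_to hmaps _).symm
    _ ≤ ∑ k ∈ Ico 1 (M + 1), Nat.card B * η ^ k := by
        refine sum_le_sum fun k hk ↦ ?_
        have hk1 : 1 ≤ k := (mem_Ico.1 hk).1
        have hcount := card_weight_le H a ha I B hB hd (k + 1) (by omega) ⊤ le_top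
        have hexp : Real.exp (-(L * k)) = (1 / (256 * (N + 1) ^ 5)) ^ k := by
          rw [show -(L * k) = (k : ℝ) * (-L) by ring, Real.exp_nat_mul, Real.exp_neg, hL,
            Real.exp_log (by linarith), one_div]
        calc ∑ x ∈ X with ⌊F x⌋₊ = k, Real.exp (-(L * ⌊F x⌋₊))
            = ∑ x ∈ X with ⌊F x⌋₊ = k, Real.exp (-(L * k)) :=
              sum_congr rfl fun x hx ↦ by rw [(mem_filter.1 hx).2]
          _ = #(X.filter fun x ↦ ⌊F x⌋₊ = k) * Real.exp (-(L * k)) := by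
              rw [sum_const, nsmul_eq_mul]
          _ ≤ (Nat.card B * (4 ^ (k + 1) * (N + 1) ^ (2 * (k + 1)))) * Real.exp (-(L * k)) := by
              gcongr
              refine le_trans ?_ (hcount.trans ?_)
              · rw [Nat.card_eq_fintype_card, Fintype.card_subtype]
                norm_cast
                refine card_le_card fun x hx ↦ ?_
                have hx := (mem_filter.1 hx).2
                simp only [mem_filter, mem_univ, true_and, AddSubgroup.mem_top]
                have := (Nat.lt_floor_add_one (F x)).le
                rw [hx] at this
                exact_mod_cast this
              · gcongr
          _ ≤ (Nat.card B * (16 * (N + 1) ^ 4) ^ k) * Real.exp (-(L * k)) := by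
              gcongr
              calc (4 : ℝ) ^ (k + 1) * (N + 1) ^ (2 * (k + 1)) = (4 * (N + 1) ^ 2) ^ (k + 1) := by
                    rw [mul_pow, pow_mul]
                _ ≤ (4 * (N + 1) ^ 2) ^ (2 * k) := by
                    refine pow_le_pow_right₀ ?_ (by omega)
                    have := one_le_pow₀ hN1 (n := 2)
                    linarith
                _ = (16 * (N + 1) ^ 4) ^ k := by
                    rw [pow_mul]; congr 1; ring
          _ = Nat.card B * η ^ k := by
              rw [hexp, mul_assoc, ← mul_pow]
              congr 2
              rw [hη]; field_simp; norm_num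
    _ = Nat.card B * ∑ k ∈ Ico 1 (M + 1), η ^ k := by rw [mul_sum]
    _ ≤ Nat.card B * (η ^ 1 / (1 - η)) := by
        gcongr
        exact geom_sum_Ico_le_of_lt_one hη0 (by linarith)
    _ ≤ Nat.card B * (2 * η) := by
        gcongr
        rw [pow_one, div_le_iff₀ (by linarith)]
        nlinarith
    _ = Nat.card B / (8 * (N + 1)) := by rw [hη]; field_simp; norm_num

/-- The number of coordinates on which `D` is supported but `A` is not. -/
noncomputable def newSupport (A D : AddSubgroup V) : ℝ := #{i | A ≤ H i ∧ ¬ D ≤ H i}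

lemma newSupport_add {A D E : AddSubgroup V} (hAD : A ≤ D) (hDE : D ≤ E) :
    newSupport H A D + newSupport H D E = newSupport H A E := by
  simp only [newSupport]
  rw [← Nat.cast_add, ← card_union_of_disjoint]
  · congr 2
    ext i
    simp only [mem_union, mem_filter, mem_univ, true_and]
    have h1 : D ≤ H i → A ≤ H i := hAD.trans
    have h2 : E ≤ H i → D ≤ H i := hDE.trans
    tauto
  · rw [disjoint_left]
    intro i
    simp only [mem_filter, mem_univ, true_and]
    tauto

/-- A chain of subgroups from `B` to `⊤` each of whose steps has the least possible density
`d k` of new support per bit among all extensions of `c k`. -/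
structure DensityFiltration (B : AddSubgroup V) (r : ℕ) (c : ℕ → AddSubgroup V) (d : ℕ → ℝ) :
    Prop where
  zero : c 0 = B
  top : c r = ⊤
  lt : ∀ k < r, c k < c (k + 1)
  pos : ∀ k < r, 0 < d k
  dense : ∀ k < r, ∀ D, c k ≤ D → d k * (lg D - lg (c k)) ≤ newSupport H (c k) D
  eq : ∀ k < r, newSupport H (c k) (c (k + 1)) = d k * (lg (c (k + 1)) - lg (c k))

lemma exists_densityFiltration (B : AddSubgroup V) (hB : ∀ D, B < D → 0 < newSupport H B D) :
    ∃ r c d, DensityFiltration H B r c d := by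
  induction B using WellFoundedGT.induction with
  | ind B ih =>
  rcases eq_or_ne B ⊤ with rfl | hne
  · exact ⟨0, fun _ ↦ ⊤, fun _ ↦ 1, rfl, rfl, by simp, by simp, by simp, by simp⟩
  have := Fintype.ofFinite (AddSubgroup V)
  obtain ⟨D, hD, hmin⟩ := exists_min_image (univ.filter (B < ·))
    (fun D ↦ newSupport H B D / (lg D - lg B)) ⟨⊤, by simpa using hne.lt_top⟩
  simp only [mem_filter, mem_univ, true_and] at hD hmin
  have hlgD := lg_add_one_le hD
  set δ := newSupport H B D / (lg D - lg B) with hδ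
  have hδ0 : 0 < δ := div_pos (hB D hD) (by linarith)
  have hδD : newSupport H B D = δ * (lg D - lg B) := by
    rw [hδ, div_mul_cancel₀]; linarith
  have hdense : ∀ E, B ≤ E → δ * (lg E - lg B) ≤ newSupport H B E := by
    intro E hE
    rcases hE.eq_or_lt with rfl | hE
    · simp [newSupport]
    · have := lg_add_one_le hE
      exact (le_div_iff₀ (by linarith)).1 (hmin E hE)
  obtain ⟨r, c, d, h⟩ := ih D hD (fun E hE ↦ by
    have h1 := hdense E (hD.trans hE).le
    have h2 := newSupport_add H hD.le hE.le
    have h3 := lg_add_one_le hE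
    nlinarith)
  refine ⟨r + 1, fun k ↦ Nat.casesOn k B c, fun k ↦ Nat.casesOn k δ d, rfl, h.top, ?_, ?_, ?_, ?_⟩
  · rintro (_ | k) hk
    · simpa [h.zero] using hD
    · exact h.lt k (by omega)
  · rintro (_ | k) hk
    · exact hδ0
    · exact h.pos k (by omega)
  · rintro (_ | k) hk
    · exact hdense
    · exact h.dense k (by omega)
  · rintro (_ | k) hk
    · simpa [h.zero] using hδD
    · exact h.eq k (by omega)

namespace DensityFiltration

variable {H} {B : AddSubgroup V} {r : ℕ} {c : ℕ → AddSubgroup V} {d : ℕ → ℝ}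

lemma mono (h : DensityFiltration H B r c d) {j k : ℕ} (hjk : j ≤ k) (hk : k ≤ r) : c j ≤ c k := by
  induction k, hjk using Nat.le_induction with
  | base => rfl
  | succ k _ ih => exact (ih (by omega)).trans (h.lt k (by omega)).le

lemma length_le (h : DensityFiltration H B r c d) {k : ℕ} (hk : k ≤ r) : lg B + k ≤ lg (c k) := by
  induction k with
  | zero => simp [h.zero]
  | succ k ih =>
    have := lg_add_one_le (h.lt k (by omega))
    have := ih (by omega)
    push_cast
    linarith

lemma density_le (h : DensityFiltration H B r c d) {k : ℕ} (hk : k + 1 < r) : d k ≤ d (k + 1) := by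
  have h1 := h.lt k (by omega)
  have h2 := h.lt (k + 1) hk
  have h3 := newSupport_add H h1.le h2.le
  have h4 := h.dense k (by omega) _ (h1.trans h2).le
  rw [← h3, h.eq k (by omega), h.eq (k + 1) hk] at h4
  have := lg_add_one_le h2
  nlinarith


/-- The last step of the chain contained in `H i`. -/
noncomputable def level (H : ι → AddSubgroup V) (c : ℕ → AddSubgroup V) (r : ℕ) (i : ι) : ℕ :=
  Nat.findGreatest (fun k ↦ c k ≤ H i) r

lemma level_le (i : ι) : level H c r i ≤ r := Nat.findGreatest_le r

lemma le_level_iff (h : DensityFiltration H ⊥ r c d) {k : ℕ} (hk : k ≤ r) {i : ι} :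
    k ≤ level H c r i ↔ c k ≤ H i := by
  refine ⟨fun hkl ↦ (h.mono hkl (level_le i)).trans ?_, fun hc ↦ Nat.le_findGreatest hk hc⟩
  exact Nat.findGreatest_spec (P := fun k ↦ c k ≤ H i) (Nat.zero_le r) (by simp [h.zero])

/-- The reciprocal of the density of the step at which the coordinate `i` enters the support. -/
noncomputable def invDensity (H : ι → AddSubgroup V) (c : ℕ → AddSubgroup V) (r : ℕ) (d : ℕ → ℝ)
    (i : ι) : ℝ :=
  if level H c r i < r then (d (level H c r i))⁻¹ else 0

lemma invDensity_nonneg (h : DensityFiltration H ⊥ r c d) (i : ι) : 0 ≤ invDensity H c r d i := by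
  rw [invDensity]
  split_ifs with hi
  · exact (inv_pos.2 (h.pos _ hi)).le
  · rfl

lemma sum_invDensity_step (h : DensityFiltration H ⊥ r c d) {k : ℕ} (hk : k < r)
    {E : AddSubgroup V} (hE : E ≤ c (k + 1)) :
    ∑ i with c k ≤ H i ∧ ¬ E ≤ H i, invDensity H c r d i = (d k)⁻¹ * newSupport H (c k) E := by
  have : ∀ i ∈ univ.filter (fun i ↦ c k ≤ H i ∧ ¬ E ≤ H i), invDensity H c r d i = (d k)⁻¹ := by
    intro i hi
    obtain ⟨h1, h2⟩ := (mem_filter.1 hi).2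
    have h3 := (h.le_level_iff hk.le).2 h1
    have h4 : ¬ k + 1 ≤ level H c r i := fun h5 ↦ h2 (hE.trans ((h.le_level_iff hk).1 h5))
    have h5 : level H c r i = k := by omega
    rw [invDensity, h5, if_pos hk]
  rw [sum_congr rfl this, sum_const, nsmul_eq_mul, newSupport, mul_comm]

lemma sum_invDensity_le (h : DensityFiltration H ⊥ r c d) :
    ∑ i, invDensity H c r d i ≤ lg (⊤ : AddSubgroup V) := by
  have key : ∀ k ≤ r, ∑ i with ¬ c k ≤ H i, invDensity H c r d i ≤ lg (c k) := by
    intro k hk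
    induction k with
    | zero => simp [h.zero, lg]
    | succ k ih =>
      have h1 := ih (by omega)
      have hk : k < r := by omega
      have hs : ∑ i with ¬ c (k + 1) ≤ H i, invDensity H c r d i =
          ∑ i with ¬ c k ≤ H i, invDensity H c r d i +
          ∑ i with c k ≤ H i ∧ ¬ c (k + 1) ≤ H i, invDensity H c r d i := by
        rw [← sum_union]
        · refine sum_congr ?_ fun _ _ ↦ rfl
          ext i
          have : c (k + 1) ≤ H i → c k ≤ H i := (h.lt k hk).le.trans
          simp only [mem_union, mem_filter, mem_univ, true_and]
          tauto
        · rw [disjoint_left]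
          intro i
          simp only [mem_filter, mem_univ, true_and]
          tauto
      rw [hs, h.sum_invDensity_step hk le_rfl, h.eq k hk, inv_mul_cancel_left₀ (h.pos k hk).ne']
      linarith
  have h1 := key r le_rfl
  rw [h.top] at h1
  refine le_trans (le_of_eq ?_) h1
  symm
  refine sum_filter_of_ne fun i _ hi hle ↦ hi ?_
  rw [invDensity, if_neg]
  rw [not_lt, h.le_level_iff le_rfl, h.top]
  exact hle

lemma lg_sub_le_sum_invDensity (h : DensityFiltration H ⊥ r c d) {j : ℕ} (hj : j ≤ r)
    {D : AddSubgroup V} (hD : c j ≤ D) :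
    lg D - lg (c j) ≤
      ∑ i ∈ univ.filter (fun i ↦ j ≤ level H c r i) with ¬ D ≤ H i, invDensity H c r d i := by
  have key : ∀ k, j ≤ k → k ≤ r → lg (D ⊓ c k) - lg (c j) ≤
      ∑ i ∈ univ.filter (fun i ↦ j ≤ level H c r i) with ¬ D ⊓ c k ≤ H i, invDensity H c r d i := by
    intro k hjk
    induction k, hjk using Nat.le_induction with
    | base =>
      intro _
      rw [inf_eq_right.2 hD, sub_self]
      exact sum_nonneg fun i _ ↦ h.invDensity_nonneg i
    | succ k hjk ih =>
      intro hk
      have hk : k < r := by omega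
      have h1 := ih hk.le
      have hc := (h.lt k hk).le
      set E := (D ⊓ c (k + 1)) ⊔ c k with hE
      have hs : ∑ i ∈ univ.filter (fun i ↦ j ≤ level H c r i) with ¬ D ⊓ c k ≤ H i,
            invDensity H c r d i +
          ∑ i with c k ≤ H i ∧ ¬ E ≤ H i, invDensity H c r d i ≤
          ∑ i ∈ univ.filter (fun i ↦ j ≤ level H c r i) with ¬ D ⊓ c (k + 1) ≤ H i,
            invDensity H c r d i := by
        rw [← sum_union]
        · refine sum_le_sum_of_subset_of_nonneg ?_ fun i _ _ ↦ h.invDensity_nonneg i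
          intro i
          have h2 : D ⊓ c (k + 1) ≤ H i → D ⊓ c k ≤ H i := (inf_le_inf_left D hc).trans
          have h3 : c k ≤ H i → j ≤ level H c r i := fun h4 ↦
            hjk.trans ((h.le_level_iff hk.le).2 h4)
          simp only [mem_union, mem_filter, mem_univ, true_and, hE, sup_le_iff]
          tauto
        · rw [disjoint_left]
          intro i
          have : c k ≤ H i → D ⊓ c k ≤ H i := inf_le_right.trans
          simp only [mem_filter, mem_univ, true_and]
          tauto
      rw [h.sum_invDensity_step hk (sup_le inf_le_right hc)] at hs
      have h2 := h.dense k hk E le_sup_right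
      have h3 := mul_le_mul_of_nonneg_left h2 (inv_pos.2 (h.pos k hk)).le
      rw [inv_mul_cancel_left₀ (h.pos k hk).ne'] at h3
      have h4 := lg_sup_add_lg_inf (D ⊓ c (k + 1)) (c k)
      rw [inf_assoc, inf_eq_right.2 hc] at h4
      linarith
  simpa [h.top] using key r hj le_rfl

/-- The increments of the densities along the filtration. -/
noncomputable def increment (d : ℕ → ℝ) : ℕ → ℝ
  | 0 => d 0
  | k + 1 => d (k + 1) - d k

lemma sum_increment (d : ℕ → ℝ) (k : ℕ) : ∑ j ∈ range (k + 1), increment d j = d k := by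
  induction k with
  | zero => simp [increment]
  | succ k ih => rw [sum_range_succ, ih, increment]; ring

lemma increment_nonneg (h : DensityFiltration H ⊥ r c d) {k : ℕ} (hk : k < r) :
    0 ≤ increment d k := by
  cases k with
  | zero => exact (h.pos 0 hk).le
  | succ k => exact sub_nonneg.2 (h.density_le hk)

lemma sum_eq_sum_increment_mul (h : DensityFiltration H ⊥ r c d) (x : V) (f : ι → ℝ) :
    ∑ i with x ∉ H i, f i = ∑ j ∈ range r, increment d j *
      ∑ i ∈ univ.filter (fun i ↦ j ≤ level H c r i) with x ∉ H i, f i * invDensity H c r d i := by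
  have e : ∀ j, ∑ i ∈ univ.filter (fun i ↦ j ≤ level H c r i) with x ∉ H i,
      f i * invDensity H c r d i =
      ∑ i with x ∉ H i, if j ≤ level H c r i then f i * invDensity H c r d i else 0 := by
    intro j
    rw [← sum_filter, filter_filter, filter_filter]
    exact sum_congr (filter_congr fun _ _ ↦ and_comm) fun _ _ ↦ rfl
  simp_rw [e, mul_sum]
  rw [sum_comm]
  refine sum_congr rfl fun i hi ↦ ?_
  have hx := (mem_filter.1 hi).2
  have hl : level H c r i < r := by
    by_contra hl
    rw [not_lt, h.le_level_iff le_rfl, h.top] at hl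
    exact hx (hl trivial)
  simp_rw [mul_ite, mul_zero]
  rw [← sum_filter, ← sum_mul]
  have e2 : (range r).filter (· ≤ level H c r i) = range (level H c r i + 1) := by
    ext j; simp only [mem_filter, mem_range]; omega
  rw [e2, sum_increment, invDensity, if_pos hl]
  have := (h.pos _ hl).ne'
  field_simp

end DensityFiltration

/-- Sparsification of a finite family of subgroups with trivial intersection. -/
theorem exists_sparsifier (hH : ∀ D, (∀ i, D ≤ H i) → D = ⊥) {ε : ℝ} (hε : 0 < ε) (hε1 : ε < 1)
    {N : ℝ} (hN : lg (⊤ : AddSubgroup V) ≤ N) :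
    ∃ (S : Finset ι) (w : ι → ℝ), (∀ i, 0 ≤ w i) ∧
      (#S : ℝ) ≤ 8 * Real.log (256 * (N + 1) ^ 5) * N / ε ^ 2 + 1 ∧
      ∀ x, |∑ i ∈ S with x ∉ H i, w i - #{i | x ∉ H i}| ≤ ε * #{i | x ∉ H i} := by
  have := Fintype.ofFinite V
  have hbot : lg (⊥ : AddSubgroup V) = 0 := by simp [lg]
  have hlg0 : ∀ A : AddSubgroup V, 0 ≤ lg A := fun A ↦ by
    linarith [lg_mono (bot_le : ⊥ ≤ A)]
  have hN0 : 0 ≤ N := (hlg0 _).trans hN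
  obtain ⟨r, c, d, h⟩ := exists_densityFiltration H ⊥ (fun D hD ↦ by
    rw [newSupport, Nat.cast_pos, card_pos]
    by_contra hne
    rw [not_nonempty_iff_eq_empty, filter_eq_empty_iff] at hne
    exact hD.ne' (hH D fun i ↦ by simpa using hne (mem_univ i)))
  have hrN : (r : ℝ) ≤ N := by
    have := h.length_le le_rfl
    rw [h.top, hbot] at this
    linarith
  set L := Real.log (256 * (N + 1) ^ 5) with hL
  have hL0 : 0 < L := by
    apply Real.log_pos
    have := one_le_pow₀ (show 1 ≤ N + 1 by linarith) (n := 5)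
    linarith
  set ρ : ℝ := 4 * L / ε ^ 2 with hρ
  have hρ0 : 0 < ρ := by positivity
  set a := DensityFiltration.invDensity H c r d with ha
  have ha0 : ∀ i, 0 ≤ a i := h.invDensity_nonneg
  set p : ι → ℝ := fun i ↦ min 1 (ρ * a i) with hp
  have hp0 : ∀ i, 0 ≤ p i := fun i ↦ le_min zero_le_one (mul_nonneg hρ0.le (ha0 i))
  have hp1 : ∀ i, p i ≤ 1 := fun i ↦ min_le_left _ _
  let T : ℕ → V → Finset ι := fun j x ↦
    (univ.filter fun i ↦ j ≤ DensityFiltration.level H c r i).filter fun i ↦ x ∉ H i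
  let F : ℕ → V → ℝ := fun j x ↦ ∑ i ∈ T j x, a i
  let Φ : ℝ → ℕ → V → Finset ι → ℝ := fun s j x S ↦
    Real.exp (s * ρ * deviation p a (T j x) S) * Real.exp (-(ε ^ 2 / 2 * ρ * F j x))
  have hΦ : ∀ s, |s| = ε / 2 → ∀ j x, ∑ S, setProb p S * Φ s j x S ≤ Real.exp (-(L * F j x)) := by
    intro s hs j x
    have h1 := sum_setProb_exp_deviation_le ha0 hρ0 (T j x) (s := s) (by rw [hs]; linarith)
    simp only [Φ]
    simp_rw [← mul_assoc]
    rw [← sum_mul]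
    refine (mul_le_mul_of_nonneg_right h1 (Real.exp_pos _).le).trans (le_of_eq ?_)
    rw [← Real.exp_add]
    congr 1
    have hs2 : s ^ 2 = ε ^ 2 / 4 := by rw [← sq_abs, hs]; ring
    have hLρ : L = ρ * ε ^ 2 / 4 := by rw [hρ]; field_simp
    rw [hs2, hLρ]
    simp only [F]
    ring
  let Ψ : ℝ → ℕ → Finset ι → ℝ := fun s j S ↦
    (Nat.card (c j) : ℝ)⁻¹ * ∑ x with x ∉ c j, Φ s j x S
  have hcpos : ∀ j, (0 : ℝ) < Nat.card (c j) := fun j ↦ by exact_mod_cast Nat.card_pos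
  have hΨ : ∀ s, |s| = ε / 2 → ∀ j < r, ∑ S, setProb p S * Ψ s j S ≤ 1 / (8 * (N + 1)) := by
    intro s hs j hj
    have h1 : ∑ S, setProb p S * Ψ s j S = (Nat.card (c j) : ℝ)⁻¹ *
        ∑ x with x ∉ c j, ∑ S, setProb p S * Φ s j x S := by
      rw [sum_comm, mul_sum]
      refine sum_congr rfl fun S _ ↦ ?_
      simp only [Ψ]
      rw [mul_sum, mul_sum, mul_sum]
      exact sum_congr rfl fun x _ ↦ by ring
    rw [h1]
    have h2 := sum_exp_neg_weight_le H a ha0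
      (univ.filter fun i ↦ j ≤ DensityFiltration.level H c r i)
      (c j) (fun i hi ↦ (h.le_level_iff hj.le).1 (mem_filter.1 hi).2)
      (fun D hD ↦ h.lg_sub_le_sum_invDensity hj.le hD) N (by linarith [hlg0 (c j)])
      (univ.filter (· ∉ c j)) (fun x hx ↦ (mem_filter.1 hx).2)
    calc (Nat.card (c j) : ℝ)⁻¹ * ∑ x with x ∉ c j, ∑ S, setProb p S * Φ s j x S
        ≤ (Nat.card (c j) : ℝ)⁻¹ * ∑ x with x ∉ c j, Real.exp (-(L * F j x)) :=
          mul_le_mul_of_nonneg_left (sum_le_sum fun x _ ↦ hΦ s hs j x)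
            (inv_nonneg.2 (hcpos j).le)
      _ ≤ (Nat.card (c j) : ℝ)⁻¹ * (Nat.card (c j) / (8 * (N + 1))) :=
          mul_le_mul_of_nonneg_left h2 (inv_nonneg.2 (hcpos j).le)
      _ = 1 / (8 * (N + 1)) := by
          have := (hcpos j).ne'
          field_simp
  let Ω : Finset ι → ℝ := fun S ↦ Real.exp (#S) * (Real.exp (-(2 * ρ * N)) / 2) +
    ∑ j ∈ range r, (Ψ (ε / 2) j S + Ψ (-(ε / 2)) j S)
  have hΩ : ∑ S, setProb p S * Ω S < ∑ S, setProb p S * 1 := by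
    simp_rw [mul_one]
    rw [sum_setProb]
    have h1 : ∑ S, setProb p S * (Real.exp (#S) * (Real.exp (-(2 * ρ * N)) / 2)) ≤ 1 / 2 := by
      simp_rw [← mul_assoc]
      rw [← sum_mul]
      have h2 := sum_setProb_exp_card_le hp0
      have h3 : Real.exp (2 * ∑ i, p i) ≤ Real.exp (2 * ρ * N) := by
        refine Real.exp_le_exp.2 ?_
        have h4 : ∑ i, p i ≤ ∑ i, ρ * a i := sum_le_sum fun i _ ↦ min_le_right _ _
        rw [← mul_sum] at h4
        have h5 := mul_le_mul_of_nonneg_left (h.sum_invDensity_le.trans hN) hρ0.le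
        linarith
      calc _ ≤ Real.exp (2 * ρ * N) * (Real.exp (-(2 * ρ * N)) / 2) :=
            mul_le_mul_of_nonneg_right (h2.trans h3) (by positivity)
        _ = 1 / 2 := by rw [← mul_div_assoc, ← Real.exp_add]; simp
    have h2 : ∑ S, setProb p S * ∑ j ∈ range r, (Ψ (ε / 2) j S + Ψ (-(ε / 2)) j S) ≤
        r * (1 / (4 * (N + 1))) := by
      simp_rw [mul_sum]
      rw [sum_comm]
      calc _ ≤ ∑ j ∈ range r, 1 / (4 * (N + 1)) := by
            refine sum_le_sum fun j hj ↦ ?_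
            simp_rw [mul_add (setProb p _)]
            rw [sum_add_distrib]
            have e1 := hΨ (ε / 2) (abs_of_pos (by linarith)) j (mem_range.1 hj)
            have e2 := hΨ (-(ε / 2)) (by rw [abs_neg]; exact abs_of_pos (by linarith)) j
              (mem_range.1 hj)
            have e3 : 1 / (4 * (N + 1)) = 1 / (8 * (N + 1)) + 1 / (8 * (N + 1)) := by
              field_simp; norm_num
            rw [e3]
            exact add_le_add e1 e2
        _ = _ := by simp
    have h3 : r * (1 / (4 * (N + 1))) ≤ 1 / 4 := by
      rw [mul_one_div, div_le_iff₀ (by linarith)]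
      linarith
    have h4 : ∑ S, setProb p S * Ω S =
        ∑ S, setProb p S * (Real.exp (#S) * (Real.exp (-(2 * ρ * N)) / 2)) +
          ∑ S, setProb p S * ∑ j ∈ range r, (Ψ (ε / 2) j S + Ψ (-(ε / 2)) j S) := by
      rw [← sum_add_distrib]
      exact sum_congr rfl fun S _ ↦ mul_add _ _ _
    linarith
  obtain ⟨S, -, hS⟩ := exists_lt_of_sum_lt hΩ
  have hS : Ω S < 1 := lt_of_mul_lt_mul_left hS (setProb_nonneg hp0 hp1 S)
  have hΦ0 : ∀ s j x, 0 ≤ Φ s j x S := fun s j x ↦ by positivity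
  have hΨ0 : ∀ s j, 0 ≤ Ψ s j S := fun s j ↦
    mul_nonneg (inv_nonneg.2 (hcpos j).le) (sum_nonneg fun x _ ↦ hΦ0 s j x)
  have hΨs0 : 0 ≤ ∑ j ∈ range r, (Ψ (ε / 2) j S + Ψ (-(ε / 2)) j S) :=
    sum_nonneg fun j _ ↦ add_nonneg (hΨ0 _ _) (hΨ0 _ _)
  have hTcongr : ∀ j < r, ∀ x, ∀ y ∈ c j, T j (x + y) = T j x := by
    intro j hj x y hy
    refine filter_congr fun i hi ↦ ?_
    have hyi : y ∈ H i := (h.le_level_iff hj.le).1 (mem_filter.1 hi).2 hy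
    rw [AddSubgroup.add_mem_cancel_right _ hyi]
  have hΦ1 : ∀ s, (∀ j, Ψ s j S ≤ Ψ (ε / 2) j S + Ψ (-(ε / 2)) j S) →
      ∀ j < r, ∀ x, x ∉ c j → Φ s j x S < 1 := by
    intro s hs j hj x hx
    by_contra! hge
    have h1 : (Nat.card (c j) : ℝ) ≤ ∑ x with x ∉ c j, Φ s j x S := by
      calc (Nat.card (c j) : ℝ) = ∑ y : c j, (1 : ℝ) := by simp
        _ ≤ ∑ y : c j, Φ s j (x + y) S := sum_le_sum fun y _ ↦ by
            simp only [Φ, F, hTcongr j hj x y y.2] at hge ⊢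
            exact hge
        _ = ∑ z ∈ univ.image (fun y : c j ↦ x + (y : V)), Φ s j z S := by
            rw [sum_image]
            intro y _ y' _ hyy
            exact Subtype.ext (add_left_cancel hyy)
        _ ≤ _ := by
            refine sum_le_sum_of_subset_of_nonneg ?_ fun z _ _ ↦ hΦ0 s j z
            intro z hz
            obtain ⟨y, -, rfl⟩ := mem_image.1 hz
            rw [mem_filter, AddSubgroup.add_mem_cancel_right _ y.2]
            exact ⟨mem_univ _, hx⟩
    have h2 : 1 ≤ Ψ s j S := by
      have := mul_le_mul_of_nonneg_left h1 (inv_nonneg.2 (hcpos j).le)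
      rwa [inv_mul_cancel₀ (hcpos j).ne'] at this
    have h3 : Ψ (ε / 2) j S + Ψ (-(ε / 2)) j S ≤
        ∑ j ∈ range r, (Ψ (ε / 2) j S + Ψ (-(ε / 2)) j S) :=
      single_le_sum (f := fun j ↦ Ψ (ε / 2) j S + Ψ (-(ε / 2)) j S)
        (fun j _ ↦ add_nonneg (hΨ0 _ _) (hΨ0 _ _)) (mem_range.2 hj)
    have h4 := hs j
    have h5 : 0 ≤ Real.exp (#S) * (Real.exp (-(2 * ρ * N)) / 2) := by positivity
    simp only [Ω] at hS
    linarith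
  have hdev : ∀ j < r, ∀ x, |deviation p a (T j x) S| ≤ ε * F j x := by
    intro j hj x
    by_cases hx : x ∈ c j
    · have : T j x = ∅ := by
        refine filter_eq_empty_iff.2 fun i hi ↦ ?_
        rw [not_not]
        exact (h.le_level_iff hj.le).1 (mem_filter.1 hi).2 hx
      simp [deviation, F, this]
    have h1 := hΦ1 (ε / 2) (fun j ↦ by linarith [hΨ0 (-(ε / 2)) j]) j hj x hx
    have h2 := hΦ1 (-(ε / 2)) (fun j ↦ by linarith [hΨ0 (ε / 2) j]) j hj x hx
    simp only [Φ, ← Real.exp_add, Real.exp_lt_one_iff] at h1 h2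
    have hpos : 0 < ε / 2 * ρ := by positivity
    rw [abs_le]
    constructor
    · by_contra! h3
      have := mul_lt_mul_of_pos_left h3 hpos
      nlinarith
    · by_contra! h3
      have := mul_lt_mul_of_pos_left h3 hpos
      nlinarith
  refine ⟨S, fun i ↦ (p i)⁻¹, fun i ↦ inv_nonneg.2 (hp0 i), ?_, fun x ↦ ?_⟩
  · have h1 : Real.exp (#S) * (Real.exp (-(2 * ρ * N)) / 2) < 1 := by
      simp only [Ω] at hS
      linarith
    have h2 : Real.exp (#S - 2 * ρ * N) < Real.exp 1 := by
      rw [sub_eq_add_neg, Real.exp_add]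
      linarith [Real.exp_one_gt_two]
    have h3 := Real.exp_lt_exp.1 h2
    have h4 : 2 * ρ * N = 8 * L * N / ε ^ 2 := by rw [hρ]; ring
    linarith
  · have h1 : ∑ i ∈ S with x ∉ H i, (p i)⁻¹ - #{i | x ∉ H i} =
        ∑ i with x ∉ H i, ((if i ∈ S then (p i)⁻¹ else 0) - 1) := by
      rw [sum_sub_distrib, ← sum_filter, filter_filter, sum_const, nsmul_eq_mul, mul_one]
      congr 1
      refine sum_congr ?_ fun _ _ ↦ rfl
      ext i; simp [and_comm]
    have h2 : (#{i | x ∉ H i} : ℝ) = ∑ i with x ∉ H i, (1 : ℝ) := by simp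
    rw [h1, h2, h.sum_eq_sum_increment_mul x, h.sum_eq_sum_increment_mul x, mul_sum]
    refine (abs_sum_le_sum_abs _ _).trans (sum_le_sum fun j hj ↦ ?_)
    have hj := mem_range.1 hj
    have h3 := hdev j hj x
    have h4 := h.increment_nonneg hj
    rw [abs_mul, abs_of_nonneg h4]
    simp only [one_mul]
    calc _ ≤ DensityFiltration.increment d j * (ε * F j x) := mul_le_mul_of_nonneg_left h3 h4
      _ = _ := by simp only [F, T]; ring

end

/-- Existence of near-linear size (1±ε) code-sparsifiers for codes over
any finite additive Abelian group. -/
theorem stmt_3 :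
    ∃ K c : ℝ, 0 < K ∧ 0 < c ∧
      ∀ (G : Type) [AddCommGroup G] [Fintype G], 2 ≤ Fintype.card G →
      ∀ (n m : ℕ), 1 ≤ n → 1 ≤ m → m ≤ Fintype.card G ^ n →
      ∀ ε : ℝ, 0 < ε → ε < 1 →
      ∀ C : AddSubgroup (Fin m → G), Nat.card C ≤ Fintype.card G ^ n →
      ∃ (S : Finset (Fin m)) (w : Fin m → ℝ),
        (∀ i ∈ S, 0 ≤ w i) ∧
        (S.card : ℝ) ≤ K * n * (Real.logb 2 (2 * (Fintype.card G : ℝ))) ^ 2 *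
          (Real.logb 2 (2 * (n : ℝ) * (Fintype.card G : ℝ) / ε)) ^ c / ε ^ 2 ∧
        ∀ x ∈ C,
          (1 - ε) * (Nat.card {i : Fin m // x i ≠ 0} : ℝ) ≤
              ∑ i ∈ S, Set.indicator {j : Fin m | x j ≠ 0} w i ∧
            ∑ i ∈ S, Set.indicator {j : Fin m | x j ≠ 0} w i ≤
              (1 + ε) * (Nat.card {i : Fin m // x i ≠ 0} : ℝ) := by
  classical
  refine ⟨200, 1, by norm_num, one_pos, ?_⟩
  intro G _ _ hq n m hn _ _ ε hε hε1 C hC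
  set q : ℝ := (Fintype.card G : ℝ) with hqdef
  have hq2 : (2 : ℝ) ≤ q := by rw [hqdef]; exact_mod_cast hq
  have hn1 : (1 : ℝ) ≤ n := by exact_mod_cast hn
  have hlogq1 : 1 ≤ Real.logb 2 q := by
    rw [Real.le_logb_iff_rpow_le (by norm_num) (by linarith)]
    simpa using hq2
  have hlogq : Real.logb 2 q ≤ q - 1 := by
    rw [Real.logb_le_iff_le_rpow (by norm_num) (by linarith)]
    have h1 := one_add_mul_self_le_rpow_one_add (s := 1) (by norm_num) (p := q - 1) (by linarith)
    norm_num at h1 ⊢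
    exact h1
  set N : ℝ := n * Real.logb 2 q with hNdef
  have hN1 : 1 ≤ N := by nlinarith
  have hN : lg (⊤ : AddSubgroup C) ≤ N := by
    have h1 : (Nat.card (⊤ : AddSubgroup C) : ℝ) ≤ q ^ n := by
      rw [AddSubgroup.card_top]
      rw [hqdef]; exact_mod_cast hC
    rw [hNdef, ← Real.logb_pow]
    exact Real.logb_le_logb_of_le (by norm_num) (by exact_mod_cast Nat.card_pos) h1
  let H : Fin m → AddSubgroup C := fun i ↦ ((Pi.evalAddMonoidHom (fun _ ↦ G) i).comp C.subtype).ker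
  have hmem : ∀ i (x : C), x ∈ H i ↔ x.1 i = 0 := fun i x ↦ Iff.rfl
  obtain ⟨S, w, hw, hcard, hS⟩ := exists_sparsifier H (fun D hD ↦ by
    rw [eq_bot_iff]
    intro x hx
    exact AddSubgroup.mem_bot.2 (Subtype.ext (funext fun i ↦ hD i hx))) hε hε1 hN
  refine ⟨S, w, fun i _ ↦ hw i, hcard.trans ?_, fun x hx ↦ ?_⟩
  · rw [Real.rpow_one]
    set Λ := Real.logb 2 (2 * (n : ℝ) * q / ε) with hΛ
    have hnq : (2 : ℝ) ≤ n * q := by nlinarith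
    have harg : 2 * (n * q) ≤ 2 * (n : ℝ) * q / ε := by
      rw [le_div_iff₀ hε]
      nlinarith
    have hΛ2 : 2 ≤ Λ := by
      rw [hΛ, Real.le_logb_iff_rpow_le (by norm_num) (by linarith)]
      norm_num
      linarith
    have hlog : Real.log (256 * (N + 1) ^ 5) ≤ 9 * Λ := by
      have h1 : N + 1 ≤ 2 * (n : ℝ) * q / ε := by nlinarith
      have h2 : Real.log 2 ≤ 1 := by linarith [Real.log_two_lt_d9]
      have h3 : Real.log (N + 1) ≤ Λ := by
        have h4 : Real.log (N + 1) ≤ Real.log (2 * (n : ℝ) * q / ε) :=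
          Real.log_le_log (by linarith) h1
        refine h4.trans ?_
        have h5 : Real.log (2 * (n : ℝ) * q / ε) = Λ * Real.log 2 := by
          rw [hΛ, Real.logb, div_mul_cancel₀]
          exact (Real.log_pos (by norm_num)).ne'
        nlinarith
      rw [Real.log_mul (by norm_num) (by positivity), Real.log_pow,
        show (256 : ℝ) = 2 ^ 8 by norm_num, Real.log_pow]
      push_cast
      linarith
    have hl2 : 1 + Real.logb 2 q = Real.logb 2 (2 * q) := by
      rw [Real.logb_mul (by norm_num) (by linarith), Real.logb_self_eq_one (by norm_num)]
    have hNl : N ≤ n * Real.logb 2 (2 * q) ^ 2 := by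
      rw [hNdef]
      gcongr
      rw [← hl2]
      nlinarith
    have hε2 : ε ^ 2 ≤ 1 := by nlinarith
    calc 8 * Real.log (256 * (N + 1) ^ 5) * N / ε ^ 2 + 1
        ≤ 8 * (9 * Λ) * N / ε ^ 2 + Λ * N / ε ^ 2 := by
          gcongr
          rw [le_div_iff₀ (by positivity)]
          nlinarith
      _ = 73 * Λ * N / ε ^ 2 := by ring
      _ ≤ 200 * Λ * (n * Real.logb 2 (2 * q) ^ 2) / ε ^ 2 := by
          gcongr
          norm_num
      _ = _ := by ring
  · have h1 := hS ⟨x, hx⟩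
    simp only [hmem] at h1
    have h2 : ∑ i ∈ S, Set.indicator {j : Fin m | x j ≠ 0} w i = ∑ i ∈ S with ¬ x i = 0, w i := by
      rw [sum_filter]
      exact sum_congr rfl fun i _ ↦ by simp [Set.indicator_apply]
    have h3 : Nat.card {i : Fin m // x i ≠ 0} = #{i | ¬ x i = 0} := by
      rw [Nat.card_eq_fintype_card, Fintype.card_subtype]
    rw [h2, h3]
    obtain ⟨h4, h5⟩ := abs_le.1 h1
    constructor <;> linarith
end

section
/- There exist absolute constants K > 0 and c > 0 such that the following holds. For every finite additive Abelian group A with |A| ≥ 2, every integer r ≥ 1, every affine predicate P : {0,1}^r → {0,1} over A, every ε ∈ (0,1), every n ≥ 1, and every instance Φ of CSP(P) on n variables, Φ admits an (ε, s)-sparsifier with s ≤ K·n·(log₂(2|A|))²·(log₂(2n|A|r/ε))^c / ε². -/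
/-- The value of a CSP instance (with predicate `P`, weights `w`, and constraint
tuples `t`) on an assignment `a`. -/
noncomputable def cspVal {n r m : ℕ} (P : (Fin r → Bool) → Bool) (w : Fin m → ℝ)
    (t : Fin m → Fin r → Fin n) (a : Fin n → Bool) : ℝ :=
  ∑ j : Fin m, w j * (if P (fun k => a (t j k)) then 1 else 0)

/-- The value of a reweighted sub-instance, retaining only the constraints in `S`
with new weights `w`. -/
noncomputable def cspValOn {n r m : ℕ} (P : (Fin r → Bool) → Bool) (S : Finset (Fin m))
    (w : Fin m → ℝ) (t : Fin m → Fin r → Fin n) (a : Fin n → Bool) : ℝ :=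
  ∑ j ∈ S, w j * (if P (fun k => a (t j k)) then 1 else 0)

open Finset in
/-- For a supermodular rank function `f` and positive weights `w`, repeatedly splitting off a set of
minimum density gives normalized weights `u` of total mass at most the rank, such that `w` is a
nonnegative combination of restrictions of `u` to complements of few sets `R`, and each such
restriction dominates the rank function contracted by `R`. -/
theorem exists_levels {ι : Type*} [Fintype ι] [DecidableEq ι] {f : Finset ι → ℝ}
    (hmono : ∀ S T, S ⊆ T → f S ≤ f T)
    (hsup : ∀ S T, f S + f T ≤ f (S ∪ T) + f (S ∩ T))
    (hgap : ∀ S T, S ⊆ T → f S < f T → f S + 1 ≤ f T)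
    {w : ι → ℝ} (hw : ∀ j, 0 < w j) :
    ∀ (S : Finset ι) (k : ℝ), 0 ≤ k →
      (∀ T, S ⊆ T → k * (f T - f S) ≤ ∑ j ∈ T \ S, w j) →
      ∃ (u : ι → ℝ) (L : Finset (Finset ι)) (c : Finset ι → ℝ),
        (∀ j, 0 ≤ u j) ∧
        (∀ T, S ⊆ T → f T - f S ≤ ∑ j ∈ T \ S, u j) ∧
        ∑ j ∈ univ \ S, u j ≤ f univ - f S ∧
        (∀ R ∈ L, S ⊆ R ∧ 0 ≤ c R ∧ ∀ T, R ⊆ T → f T - f R ≤ ∑ j ∈ T \ R, u j) ∧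
        (#L : ℝ) ≤ f univ - f S ∧
        ∀ j ∉ S, f (univ.erase j) < f univ →
          w j = k * u j + ∑ R ∈ L, if j ∈ R then 0 else c R * u j := by
  intro S
  induction hn : #(univ \ S) using Nat.strong_induction_on generalizing S with
  | _ n ih =>
  intro k hk hkS
  rcases (hmono S univ (subset_univ _)).eq_or_lt with h | h
  · refine ⟨0, ∅, 0, by simp, ?_, by simp [h], by simp, by simp [h], ?_⟩
    · intro T hT
      have := hmono T univ (subset_univ _)
      simp; linarith
    · intro j hj hlt
      have := hmono S (univ.erase j) (fun x hx => by
        simp only [mem_erase, mem_univ, and_true]; rintro rfl; exact hj hx)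
      linarith
  obtain ⟨S₁, hS₁, hmin⟩ := exists_min_image (univ.filter fun T => S ⊆ T ∧ f S < f T)
    (fun T => (∑ j ∈ T \ S, w j) / (f T - f S)) ⟨univ, by simp [h]⟩
  simp only [mem_filter, mem_univ, true_and, and_imp] at hS₁ hmin
  obtain ⟨hSS₁, hlt⟩ := hS₁
  set k₁ := (∑ j ∈ S₁ \ S, w j) / (f S₁ - f S) with hk₁
  have hd : 0 < f S₁ - f S := by linarith
  have hk₁w : k₁ * (f S₁ - f S) = ∑ j ∈ S₁ \ S, w j := by rw [hk₁]; field_simp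
  have hne : (S₁ \ S).Nonempty := by
    rw [sdiff_nonempty]; intro h'; rw [Subset.antisymm h' hSS₁] at hlt; exact lt_irrefl _ hlt
  have hk₁pos : 0 < k₁ := div_pos (sum_pos (fun j _ => hw j) hne) hd
  have hk₁S : ∀ T, S ⊆ T → k₁ * (f T - f S) ≤ ∑ j ∈ T \ S, w j := by
    intro T hT
    rcases (hmono S T hT).eq_or_lt with h' | h'
    · rw [h']; simpa using sum_nonneg fun j _ => (hw j).le
    · exact (le_div_iff₀ (by linarith)).1 (hmin T hT h')
  have hkk₁ : k ≤ k₁ := by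
    have := hkS S₁ hSS₁
    rw [← hk₁w] at this
    exact le_of_mul_le_mul_right this hd
  have hsplit : ∀ (g : ι → ℝ) T, S₁ ⊆ T →
      ∑ j ∈ T \ S, g j = ∑ j ∈ T \ S₁, g j + ∑ j ∈ S₁ \ S, g j := by
    intro g T hT
    rw [← sum_union]
    · congr 1; ext x; simp only [mem_sdiff, mem_union]
      constructor
      · rintro ⟨h1, h2⟩; by_cases x ∈ S₁ <;> simp_all
      · rintro (⟨h1, h2⟩ | ⟨h1, h2⟩)
        · exact ⟨h1, fun h => h2 (hSS₁ h)⟩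
        · exact ⟨hT h1, h2⟩
    · exact disjoint_left.2 fun x hx hx' => (mem_sdiff.1 hx).2 (mem_sdiff.1 hx').1
  obtain ⟨u, L, c, hu, huS, husum, hL, hLcard, hwu⟩ := ih #(univ \ S₁) (by
      rw [← hn]; refine card_lt_card ⟨sdiff_subset_sdiff le_rfl hSS₁, fun h' => ?_⟩
      obtain ⟨x, hx⟩ := hne
      have := h' (mem_sdiff.2 ⟨mem_univ x, (mem_sdiff.1 hx).2⟩)
      exact (mem_sdiff.1 this).2 (mem_sdiff.1 hx).1) S₁ rfl k₁ hk₁pos.le (by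
      intro T hT
      have h1 := hk₁S T (hSS₁.trans hT)
      rw [hsplit w T hT] at h1
      linarith)
  have hSL : S ∉ L := fun hS => by
    obtain ⟨x, hx⟩ := hne
    exact (mem_sdiff.1 hx).2 ((hL S hS).1 (mem_sdiff.1 hx).1)
  set v : ι → ℝ := fun j => if j ∈ S₁ then w j / k₁ else u j with hv
  have hv_out : ∀ R T, S₁ ⊆ R → ∑ j ∈ T \ R, v j = ∑ j ∈ T \ R, u j := by
    intro R T hR
    refine sum_congr rfl fun j hj => if_neg fun h' => (mem_sdiff.1 hj).2 (hR h')
  have hv_in : ∀ T, T ⊆ S₁ → ∑ j ∈ T \ S, v j = (∑ j ∈ T \ S, w j) / k₁ := by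
    intro T hT
    rw [sum_div]
    exact sum_congr rfl fun j hj => if_pos (hT (mem_sdiff.1 hj).1)
  have hvnn : ∀ j, 0 ≤ v j := by
    intro j; simp only [hv]; split_ifs
    exacts [(div_pos (hw j) hk₁pos).le, hu j]
  have hvS : ∀ T, S ⊆ T → f T - f S ≤ ∑ j ∈ T \ S, v j := by
    intro T hT
    have e : ∑ j ∈ T \ S, v j = ∑ j ∈ (T ∩ S₁) \ S, v j + ∑ j ∈ (T ∪ S₁) \ S₁, v j := by
      rw [← sum_union]
      · congr 1; ext x; simp only [mem_sdiff, mem_union, mem_inter]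
        have := @hSS₁ x
        tauto
      · exact disjoint_left.2 fun x hx hx' =>
          (mem_sdiff.1 hx').2 (mem_inter.1 (mem_sdiff.1 hx).1).2
    rw [e, hv_in _ inter_subset_right, hv_out _ _ le_rfl]
    have h1 := hk₁S (T ∩ S₁) (subset_inter hT hSS₁)
    have h2 := huS (T ∪ S₁) subset_union_right
    have h3 := hsup T S₁
    have h4 : f (T ∩ S₁) - f S ≤ (∑ j ∈ (T ∩ S₁) \ S, w j) / k₁ := by
      rw [le_div_iff₀ hk₁pos]; linarith
    linarith
  refine ⟨v, insert S L, fun R => if R = S then k₁ - k else c R, hvnn, hvS, ?_, ?_, ?_, ?_⟩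
  · rw [hsplit v univ (subset_univ _), hv_in S₁ le_rfl, hv_out _ _ le_rfl, ← hk₁w,
      mul_div_cancel_left₀ _ hk₁pos.ne']
    linarith
  · intro R hR
    rcases mem_insert.1 hR with rfl | hR
    · exact ⟨le_rfl, by simp [hkk₁], hvS⟩
    · obtain ⟨h1, h2, h3⟩ := hL R hR
      have hRS : R ≠ S := fun h' => hSL (h' ▸ hR)
      refine ⟨hSS₁.trans h1, ?_, fun T hT => ?_⟩
      · dsimp only
        rw [if_neg hRS]; exact h2
      · rw [hv_out R T h1]; exact h3 T hT
  · rw [card_insert_of_notMem hSL]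
    have := hgap S S₁ hSS₁ hlt
    push_cast; linarith
  · intro j hj hess
    rw [sum_insert hSL, if_neg hj]
    dsimp only
    rw [if_pos rfl]
    have e : ∀ R ∈ L, (if j ∈ R then 0 else (if R = S then k₁ - k else c R) * v j)
        = if j ∈ R then 0 else c R * v j := by
      intro R hR
      rw [if_neg (by rintro rfl; exact hSL hR : R ≠ S)]
    rw [sum_congr rfl e]
    by_cases hj₁ : j ∈ S₁
    · rw [sum_eq_zero fun R hR => if_pos ((hL R hR).1 hj₁)]
      have : v j = w j / k₁ := if_pos hj₁
      rw [this]; field_simp; ring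
    · have h1 := hwu j hj₁ hess
      have : v j = u j := if_neg hj₁
      rw [this]; linarith

/-- A moment generating function bound for a centred, rescaled Bernoulli variable. -/
theorem bernoulli_exp_le {u η τ : ℝ} (hu : 0 ≤ u) (hη : 0 < η) (hτ : |τ| ≤ 1) :
    u / max u η * Real.exp (τ / η * (max u η - u)) +
      (1 - u / max u η) * Real.exp (τ / η * (0 - u)) ≤ Real.exp (τ ^ 2 / η * u) := by
  rcases le_total η u with h | h
  · have hu' : u ≠ 0 := by linarith
    rw [max_eq_left h, div_self hu']
    simp only [sub_self, mul_zero, Real.exp_zero, zero_mul, one_mul, add_zero]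
    exact Real.one_le_exp (by positivity)
  · rw [max_eq_right h]
    have e1 : τ / η * (η - u) = τ + -(τ / η * u) := by field_simp; ring
    have e2 : τ / η * (0 - u) = -(τ / η * u) := by ring
    rw [e1, e2, Real.exp_add]
    have h1 := Real.add_one_le_exp (u / η * (Real.exp τ - 1))
    have h2 := (abs_le.1 (Real.abs_exp_sub_one_sub_id_le hτ)).2
    have hp : 0 ≤ u / η := by positivity
    calc _ = (u / η * (Real.exp τ - 1) + 1) * Real.exp (-(τ / η * u)) := by ring
      _ ≤ Real.exp (u / η * (Real.exp τ - 1)) * Real.exp (-(τ / η * u)) := by gcongr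
      _ = Real.exp (u / η * (Real.exp τ - 1 - τ)) := by
        rw [← Real.exp_add]; congr 1; ring
      _ ≤ Real.exp (u / η * τ ^ 2) := by gcongr
      _ = _ := by congr 1; ring

open Finset in
/-- Sampling each `j` with probability `u j / max (u j) η` and reweighting preserves, with positive
probability, the `u`-weights of all the sets `D i`. -/
theorem exists_sample {ι κ : Type*} [Fintype ι] [DecidableEq ι] {u : ι → ℝ} (hu : ∀ j, 0 ≤ u j)
    {η ε : ℝ} (hη : 0 < η) (hε : 0 < ε) (hε1 : ε < 1) (s : Finset κ) (D : κ → Finset ι)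
    (hs : ∑ i ∈ s, 2 * Real.exp (-(ε ^ 2 / (4 * η) * ∑ j ∈ D i, u j)) ≤ 1 / 2) :
    ∃ X : Finset ι, (#X : ℝ) * Real.log 2 ≤ 2 * Real.log 2 + (∑ j, u j) / η ∧
      ∀ i ∈ s, |∑ j ∈ D i, (if j ∈ X then max (u j) η else 0) - ∑ j ∈ D i, u j|
        ≤ ε * ∑ j ∈ D i, u j := by
  set p : ι → ℝ := fun j => u j / max (u j) η with hp
  have hmax : ∀ j, 0 < max (u j) η := fun j => lt_max_of_lt_right hη
  have hp0 : ∀ j, 0 ≤ p j := fun j => div_nonneg (hu j) (hmax j).le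
  have hp1 : ∀ j, p j ≤ 1 := fun j => (div_le_one (hmax j)).2 (le_max_left _ _)
  set μ : Finset ι → ℝ := fun X => (∏ j ∈ X, p j) * ∏ j ∈ univ \ X, (1 - p j) with hμ
  have hμ0 : ∀ X, 0 ≤ μ X := fun X =>
    mul_nonneg (prod_nonneg fun j _ => hp0 j) (prod_nonneg fun j _ => by linarith [hp1 j])
  have hE : ∀ a b : ι → ℝ, ∑ X, μ X * ∏ j, (if j ∈ X then a j else b j)
      = ∏ j, (p j * a j + (1 - p j) * b j) := by
    intro a b
    rw [prod_add, powerset_univ]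
    refine sum_congr rfl fun X _ => ?_
    rw [prod_ite, prod_mul_distrib, prod_mul_distrib]
    have e1 : univ.filter (fun j => j ∈ X) = X := by ext; simp
    have e2 : univ.filter (fun j => j ∉ X) = univ \ X := by ext; simp
    rw [e1, e2]; simp only [hμ]; ring
  have hμ1 : ∑ X, μ X = 1 := by
    have := hE 1 1
    simpa using this
  have htail : ∀ τ, |τ| ≤ 1 → ∀ i,
      ∑ X, μ X * Real.exp (τ / η * (∑ j ∈ D i, (if j ∈ X then max (u j) η else 0)
        - ∑ j ∈ D i, u j)) ≤ Real.exp (τ ^ 2 / η * ∑ j ∈ D i, u j) := by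
    intro τ hτ i
    have e : ∀ X : Finset ι, Real.exp (τ / η * (∑ j ∈ D i, (if j ∈ X then max (u j) η else 0)
        - ∑ j ∈ D i, u j)) = ∏ j, (if j ∈ X then
          (if j ∈ D i then Real.exp (τ / η * (max (u j) η - u j)) else 1)
          else (if j ∈ D i then Real.exp (τ / η * (0 - u j)) else 1)) := by
      intro X
      rw [← sum_sub_distrib, mul_sum, Real.exp_sum, ← prod_subset (subset_univ (D i))]
      · refine prod_congr rfl fun j hj => ?_
        rw [if_pos hj, if_pos hj]; split_ifs <;> rfl
      · intro j _ hj; simp [hj]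
    simp_rw [e]
    rw [hE, mul_sum, Real.exp_sum, ← prod_subset (subset_univ (D i))]
    · refine prod_le_prod (fun j _ => ?_) fun j hj => ?_
      · have := hp1 j
        refine add_nonneg (mul_nonneg (hp0 j) ?_) (mul_nonneg (by linarith) ?_)
        all_goals
          split_ifs
          all_goals positivity
      · rw [if_pos hj, if_pos hj]
        exact bernoulli_exp_le (hu j) hη hτ
    · intro j _ hj; simp [hj]
  set θ := ε / 2 / η with hθ
  have hθ0 : 0 < θ := by positivity
  set Y : Finset ι → κ → ℝ := fun X i => ∑ j ∈ D i, (if j ∈ X then max (u j) η else 0) with hY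
  set α : κ → ℝ := fun i => ∑ j ∈ D i, u j with hα
  set F : Finset ι → ℝ := fun X => ∑ i ∈ s,
      (Real.exp (θ * (Y X i - α i)) + Real.exp (-θ * (Y X i - α i))) * Real.exp (-(θ * ε * α i))
      + 2 ^ #X * Real.exp (-((∑ j, u j) / η)) / 4 with hF
  have hsize : ∑ X, μ X * 2 ^ #X ≤ Real.exp ((∑ j, u j) / η) := by
    have e : ∀ X : Finset ι, (2 : ℝ) ^ #X = ∏ j, (if j ∈ X then 2 else 1) := by
      intro X; rw [prod_ite]; simp
    simp_rw [e]
    rw [hE (fun _ => 2) (fun _ => 1), sum_div, Real.exp_sum]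
    refine prod_le_prod (fun j _ => by linarith [hp0 j]) fun j _ => ?_
    have h1 : p j ≤ u j / η := div_le_div_of_nonneg_left (hu j) hη (le_max_right _ _)
    have h2 := Real.add_one_le_exp (u j / η)
    linarith
  have hEF : ∑ X, μ X * F X ≤ 3 / 4 := by
    have e : ∑ X, μ X * F X = ∑ i ∈ s, (∑ X, μ X * Real.exp (θ * (Y X i - α i))
        + ∑ X, μ X * Real.exp (-θ * (Y X i - α i))) * Real.exp (-(θ * ε * α i))
        + (∑ X, μ X * 2 ^ #X) * (Real.exp (-((∑ j, u j) / η)) / 4) := by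
      simp only [hF, mul_add, sum_add_distrib, mul_sum]
      congr 1
      · rw [sum_comm]
        refine sum_congr rfl fun i _ => ?_
        rw [add_mul, sum_mul, sum_mul, ← sum_add_distrib]
        exact sum_congr rfl fun X _ => by ring
      · rw [sum_mul]; exact sum_congr rfl fun X _ => by ring
    rw [e]
    have h1 : (∑ X, μ X * 2 ^ #X) * (Real.exp (-((∑ j, u j) / η)) / 4) ≤ 1 / 4 := by
      calc _ ≤ Real.exp ((∑ j, u j) / η) * (Real.exp (-((∑ j, u j) / η)) / 4) := by gcongr
        _ = 1 / 4 := by rw [mul_div_assoc', ← Real.exp_add]; simp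
    have h2 : ∑ i ∈ s, (∑ X, μ X * Real.exp (θ * (Y X i - α i))
        + ∑ X, μ X * Real.exp (-θ * (Y X i - α i))) * Real.exp (-(θ * ε * α i)) ≤
        ∑ i ∈ s, 2 * Real.exp (-(ε ^ 2 / (4 * η) * α i)) := by
      refine sum_le_sum fun i _ => ?_
      have t1 := htail (ε / 2) (by rw [abs_of_pos (by positivity)]; linarith) i
      have t2 := htail (-(ε / 2)) (by rw [abs_neg, abs_of_pos (by positivity)]; linarith) i
      have e2 : -(ε / 2) / η = -θ := by rw [hθ]; ring
      rw [e2] at t2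
      calc _ ≤ (Real.exp ((ε / 2) ^ 2 / η * α i) + Real.exp ((-(ε / 2)) ^ 2 / η * α i))
            * Real.exp (-(θ * ε * α i)) := by gcongr
        _ = 2 * (Real.exp ((ε / 2) ^ 2 / η * α i) * Real.exp (-(θ * ε * α i))) := by
          rw [neg_sq]; ring
        _ = _ := by
          rw [← Real.exp_add]; congr 2; rw [hθ]; field_simp; ring
    linarith
  obtain ⟨X, hX⟩ : ∃ X, F X < 1 := by
    by_contra! hcon
    have : ∑ X, μ X * 1 ≤ ∑ X, μ X * F X :=
      sum_le_sum fun X _ => mul_le_mul_of_nonneg_left (hcon X) (hμ0 X)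
    simp only [mul_one, hμ1] at this
    linarith
  have hnn : ∀ i ∈ s, 0 ≤ (Real.exp (θ * (Y X i - α i)) + Real.exp (-θ * (Y X i - α i)))
      * Real.exp (-(θ * ε * α i)) := fun i _ => by positivity
  refine ⟨X, ?_, fun i hi => ?_⟩
  · have h1 : (2 : ℝ) ^ #X * Real.exp (-((∑ j, u j) / η)) / 4 < 1 := by
      have := sum_nonneg hnn
      simp only [hF] at hX; linarith
    have h2 : (2 : ℝ) ^ #X ≤ 2 ^ 2 * Real.exp ((∑ j, u j) / η) := by
      rw [Real.exp_neg] at h1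
      have := Real.exp_pos ((∑ j, u j) / η)
      field_simp at h1
      linarith
    have h3 := Real.log_le_log (by positivity) h2
    rw [Real.log_mul (by positivity) (by positivity), Real.log_exp, Real.log_pow,
      Real.log_pow] at h3
    exact_mod_cast h3
  · have h1 : (Real.exp (θ * (Y X i - α i)) + Real.exp (-θ * (Y X i - α i)))
      * Real.exp (-(θ * ε * α i)) < 1 := by
      have h2 := single_le_sum hnn hi
      have h3 : (0 : ℝ) ≤ 2 ^ #X * Real.exp (-((∑ j, u j) / η)) / 4 := by positivity
      simp only [hF] at hX; linarith
    rw [add_mul, ← Real.exp_add, ← Real.exp_add] at h1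
    have h2 : θ * (Y X i - α i) + -(θ * ε * α i) < 0 :=
      Real.exp_lt_one_iff.1 (by linarith [Real.exp_pos (-θ * (Y X i - α i) + -(θ * ε * α i))])
    have h3 : -θ * (Y X i - α i) + -(θ * ε * α i) < 0 :=
      Real.exp_lt_one_iff.1 (by linarith [Real.exp_pos (θ * (Y X i - α i) + -(θ * ε * α i))])
    rw [abs_le]
    constructor
    · have : 0 ≤ θ * ((Y X i - α i) + ε * α i) := by linarith
      linarith [nonneg_of_mul_nonneg_right this hθ0]
    · have : 0 ≤ θ * (ε * α i - (Y X i - α i)) := by linarith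
      linarith [nonneg_of_mul_nonneg_right this hθ0]

open Classical in
/-- The coordinates `j` at which the codeword `h` is nonzero, i.e. `h ∉ N j`. -/
noncomputable def codeSupp {G ι : Type*} [AddCommGroup G] [Fintype ι] (N : ι → AddSubgroup G)
    (h : G) : Finset ι := Finset.univ.filter fun j => h ∉ N j

/-- The subgroup of codewords supported in `T`. -/
def supportedIn {G ι : Type*} [AddCommGroup G] (N : ι → AddSubgroup G)
    (T : Finset ι) : AddSubgroup G := ⨅ j, ⨅ (_ : j ∉ T), N j

/-- The binary logarithm of the number of codewords supported in `T`. -/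
noncomputable def codeRank {G ι : Type*} [AddCommGroup G] (N : ι → AddSubgroup G)
    (T : Finset ι) : ℝ := Real.logb 2 (Nat.card (supportedIn N T))

section Code

variable {G ι : Type*} [AddCommGroup G] (N : ι → AddSubgroup G)

theorem mem_supportedIn {T : Finset ι} {h : G} : h ∈ supportedIn N T ↔ ∀ j ∉ T, h ∈ N j := by
  simp [supportedIn, AddSubgroup.mem_iInf]

theorem supportedIn_mono {S T : Finset ι} (hST : S ⊆ T) : supportedIn N S ≤ supportedIn N T := by
  intro h hh
  rw [mem_supportedIn] at hh ⊢
  exact fun j hj => hh j fun hS => hj (hST hS)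

theorem mem_codeSupp [Fintype ι] {h : G} {j : ι} : j ∈ codeSupp N h ↔ h ∉ N j := by
  simp [codeSupp]

theorem mem_supportedIn_iff_codeSupp_subset [Fintype ι] {T : Finset ι} {h : G} :
    h ∈ supportedIn N T ↔ codeSupp N h ⊆ T := by
  rw [mem_supportedIn]
  refine forall_congr' fun j => ?_
  rw [mem_codeSupp]; tauto

variable [Finite G]

theorem codeRank_mono {S T : Finset ι} (hST : S ⊆ T) : codeRank N S ≤ codeRank N T := by
  refine Real.logb_le_logb_of_le (by norm_num) (by exact_mod_cast Nat.card_pos) ?_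
  exact_mod_cast AddSubgroup.card_le_of_le (supportedIn_mono N hST)

theorem codeRank_nonneg (T : Finset ι) : 0 ≤ codeRank N T :=
  Real.logb_nonneg (by norm_num) (by exact_mod_cast Nat.card_pos)

theorem codeRank_le (T : Finset ι) : codeRank N T ≤ Real.logb 2 (Nat.card G) := by
  refine Real.logb_le_logb_of_le (by norm_num) (by exact_mod_cast Nat.card_pos) ?_
  exact_mod_cast Nat.card_le_card_of_injective _ (supportedIn N T).subtype_injective

theorem codeRank_add_one_le {S T : Finset ι} (hST : S ⊆ T)
    (hne : supportedIn N S ≠ supportedIn N T) : codeRank N S + 1 ≤ codeRank N T := by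
  have hle := supportedIn_mono N hST
  obtain ⟨k, hk⟩ := AddSubgroup.card_dvd_of_le hle
  have hS : 0 < Nat.card (supportedIn N S) := Nat.card_pos
  have hT : 0 < Nat.card (supportedIn N T) := Nat.card_pos
  have hk0 : k ≠ 0 := by rintro rfl; omega
  have hk1 : k ≠ 1 := by
    rintro rfl
    exact hne (AddSubgroup.eq_of_le_of_card_ge hle (by omega))
  have h2 : Nat.card (supportedIn N S) * 2 ≤ Nat.card (supportedIn N T) := by
    rw [hk]; exact Nat.mul_le_mul_left _ (by omega)
  have hlog : Real.logb 2 ((Nat.card (supportedIn N S) : ℝ) * 2) = codeRank N S + 1 := by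
    rw [Real.logb_mul (by exact_mod_cast hS.ne') (by norm_num), Real.logb_self_eq_one (by norm_num)]
    rfl
  rw [← hlog]
  exact Real.logb_le_logb_of_le (by norm_num) (by positivity) (by exact_mod_cast h2)

theorem codeRank_supermodular [DecidableEq ι] (S T : Finset ι) :
    codeRank N S + codeRank N T ≤ codeRank N (S ∪ T) + codeRank N (S ∩ T) := by
  have hinf : supportedIn N S ⊓ supportedIn N T = supportedIn N (S ∩ T) := by
    ext h
    simp only [AddSubgroup.mem_inf, mem_supportedIn, Finset.mem_inter]
    constructor
    · rintro ⟨h1, h2⟩ j hj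
      by_cases hS : j ∈ S
      · exact h2 j fun hT => hj ⟨hS, hT⟩
      · exact h1 j hS
    · exact fun h1 => ⟨fun j hj => h1 j fun h' => hj h'.1, fun j hj => h1 j fun h' => hj h'.2⟩
  have hsup : supportedIn N S ⊔ supportedIn N T ≤ supportedIn N (S ∪ T) :=
    sup_le (supportedIn_mono N Finset.subset_union_left)
      (supportedIn_mono N Finset.subset_union_right)
  have hcard : Nat.card (supportedIn N S) * Nat.card (supportedIn N T)
      = Nat.card ↥(supportedIn N S ⊔ supportedIn N T)
        * Nat.card ↥(supportedIn N S ⊓ supportedIn N T) := by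
    have h1 := AddSubgroup.relIndex_sup_right (supportedIn N S) (supportedIn N T)
    have h2 := AddSubgroup.relIndex_mul_relIndex ⊥ (supportedIn N T)
      (supportedIn N S ⊔ supportedIn N T) bot_le le_sup_right
    have h3 := AddSubgroup.relIndex_mul_relIndex ⊥ (supportedIn N S ⊓ supportedIn N T)
      (supportedIn N S) bot_le inf_le_left
    simp only [AddSubgroup.relIndex_bot_left, AddSubgroup.inf_relIndex_left] at h2 h3
    rw [← h2, ← h3, h1]; ring
  have hle : Nat.card (supportedIn N S) * Nat.card (supportedIn N T)
      ≤ Nat.card (supportedIn N (S ∪ T)) * Nat.card (supportedIn N (S ∩ T)) := by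
    rw [hcard, hinf]
    exact Nat.mul_le_mul_right _ (AddSubgroup.card_le_of_le hsup)
  have pos : ∀ R : Finset ι, (0 : ℝ) < Nat.card (supportedIn N R) := fun R => by
    exact_mod_cast Nat.card_pos
  unfold codeRank
  rw [← Real.logb_mul (pos _).ne' (pos _).ne', ← Real.logb_mul (pos _).ne' (pos _).ne']
  exact Real.logb_le_logb_of_le (by norm_num) (mul_pos (pos _) (pos _)) (by exact_mod_cast hle)

end Code

open Classical Finset in
/-- The supports, outside `S`, of the codewords supported in `T`. -/
noncomputable def contractedSupports {G ι : Type*} [AddCommGroup G] [Fintype ι]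
    (N : ι → AddSubgroup G) (S T : Finset ι) : Finset (Finset ι) :=
  univ.filter fun D => ∃ h ∈ supportedIn N T, codeSupp N h \ S = D

section Counting

open Classical Finset

variable {G ι : Type*} [AddCommGroup G] [Fintype ι] (N : ι → AddSubgroup G)

theorem mem_contractedSupports {S T D : Finset ι} :
    D ∈ contractedSupports N S T ↔ ∃ h ∈ supportedIn N T, codeSupp N h \ S = D := by
  simp [contractedSupports]

variable [Finite G]

theorem card_contractedSupports_le {S T : Finset ι} (hST : S ⊆ T) :
    (#(contractedSupports N S T) : ℝ) ≤ 2 ^ (codeRank N T - codeRank N S) := by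
  have := Fintype.ofFinite G
  set HT : Finset G := univ.filter (· ∈ supportedIn N T) with hHT
  set HS : Finset G := univ.filter (· ∈ supportedIn N S) with hHS
  have cT : Nat.card (supportedIn N T) = #HT := by
    rw [Nat.card_eq_fintype_card, Fintype.card_subtype]
  have cS : Nat.card (supportedIn N S) = #HS := by
    rw [Nat.card_eq_fintype_card, Fintype.card_subtype]
  have himg : contractedSupports N S T = HT.image fun h => codeSupp N h \ S := by
    ext D; simp [mem_contractedSupports, hHT]
  have hle : #HS * #(contractedSupports N S T) ≤ #HT := by
    rw [himg]
    refine mul_card_image_le_card _ _ fun D hD => ?_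
    obtain ⟨h, hh, rfl⟩ := mem_image.1 hD
    refine card_le_card_of_injOn (fun s => h + s) (fun s hs => ?_)
      (fun a _ b _ hab => by simpa using hab)
    simp only [hHS, hHT, coe_filter, mem_univ, true_and, Set.mem_ofPred_eq, mem_filter] at hs hh ⊢
    refine ⟨add_mem hh (supportedIn_mono N hST hs), ?_⟩
    ext j
    simp only [mem_sdiff, mem_codeSupp]
    refine and_congr_left fun hj => not_congr ?_
    exact AddSubgroup.add_mem_cancel_right _ ((mem_supportedIn N).1 hs j hj)
  have pS : (0 : ℝ) < Nat.card (supportedIn N S) := by exact_mod_cast Nat.card_pos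
  have pT : (0 : ℝ) < Nat.card (supportedIn N T) := by exact_mod_cast Nat.card_pos
  rw [Real.rpow_sub (by norm_num), codeRank, codeRank, Real.rpow_logb (by norm_num) (by norm_num) pT,
    Real.rpow_logb (by norm_num) (by norm_num) pS, le_div_iff₀ pS, cS, cT]
  rw [mul_comm]; exact_mod_cast hle

theorem exp_mul_log_le {k α : ℝ} (hα : 0 ≤ α) (hk : 1 ≤ k) (h : 2 * α ≤ k) :
    Real.exp (α * (4 * Real.log k)) ≤ Real.exp (α * (4 * Real.log (k + 1))) * (1 - α / k) := by
  have hk0 : 0 < k := by linarith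
  set x := α / k with hx
  have hx0 : 0 ≤ x := by positivity
  have hx2 : x ≤ 1 / 2 := by rw [hx, div_le_iff₀ hk0]; linarith
  have hα' : α = x * k := by rw [hx]; field_simp
  have hlog : 1 / (2 * k) ≤ Real.log (k + 1) - Real.log k := by
    rw [← Real.log_div (by positivity) (by positivity)]
    have h1 := Real.one_sub_inv_le_log_of_pos (show 0 < (k + 1) / k by positivity)
    have h2 : 1 - ((k + 1) / k)⁻¹ = 1 / (k + 1) := by field_simp; ring
    have h3 : 1 / (2 * k) ≤ 1 / (k + 1) := one_div_le_one_div_of_le (by positivity) (by linarith)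
    linarith
  have h1 : 1 ≤ Real.exp (2 * x) * (1 - x) := by
    have := Real.add_one_le_exp (2 * x)
    calc 1 ≤ (2 * x + 1) * (1 - x) := by nlinarith
      _ ≤ _ := by
        apply mul_le_mul_of_nonneg_right this; linarith
  have h2 : α * (4 * Real.log k) + 2 * x ≤ α * (4 * Real.log (k + 1)) := by
    have h4 : α * 4 * (1 / (2 * k)) = 2 * x := by rw [hα']; field_simp; ring
    have := mul_le_mul_of_nonneg_left hlog (by positivity : 0 ≤ α * 4)
    linarith
  calc Real.exp (α * (4 * Real.log k))
      ≤ Real.exp (α * (4 * Real.log k)) * (Real.exp (2 * x) * (1 - x)) :=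
        le_mul_of_one_le_right (Real.exp_pos _).le h1
    _ = Real.exp (α * (4 * Real.log k) + 2 * x) * (1 - x) := by rw [Real.exp_add]; ring
    _ ≤ _ := by
      apply mul_le_mul_of_nonneg_right (Real.exp_le_exp.2 h2); linarith

/-- A Karger-type bound on the number of light supports. -/
theorem card_light_contractedSupports_le {u : ι → ℝ} (hu : ∀ j, 0 ≤ u j) {S : Finset ι}
    (hS : ∀ T, S ⊆ T → codeRank N T - codeRank N S ≤ ∑ j ∈ T \ S, u j) {α : ℝ} (hα : 0 ≤ α) :
    ∀ T, S ⊆ T → (#((contractedSupports N S T).filter fun D => ∑ j ∈ D, u j ≤ α) : ℝ) ≤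
      Real.exp (α * (2 * Real.log 2 + 4 * Real.log (codeRank N T - codeRank N S + 1))) := by
  intro T
  induction hn : #T using Nat.strong_induction_on generalizing T with
  | _ n ih =>
  intro hT
  set k := codeRank N T - codeRank N S with hk
  have hk0 : 0 ≤ k := by linarith [codeRank_mono N hT]
  by_cases hrel : ∃ j ∈ T \ S, supportedIn N (T.erase j) = supportedIn N T
  · obtain ⟨j, hj, he⟩ := hrel
    rw [mem_sdiff] at hj
    have h1 := ih #(T.erase j) (by rw [← hn]; exact card_erase_lt_of_mem hj.1) (T.erase j) rfl
      (subset_erase.2 ⟨hT, hj.2⟩)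
    unfold contractedSupports codeRank at h1
    rw [he] at h1
    exact h1
  push Not at hrel
  by_cases hk2 : k ≤ 2 * α
  · calc _ ≤ (#(contractedSupports N S T) : ℝ) := by exact_mod_cast card_filter_le _ _
      _ ≤ 2 ^ k := card_contractedSupports_le N hT
      _ = Real.exp (k * Real.log 2) := by
        rw [Real.rpow_def_of_pos (by norm_num), mul_comm]
      _ ≤ _ := by
        have l1 : 0 ≤ Real.log (k + 1) := Real.log_nonneg (by linarith)
        have l2 : 0 ≤ Real.log 2 := Real.log_nonneg (by norm_num)
        have l3 := mul_nonneg hα l1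
        have l4 := mul_le_mul_of_nonneg_right hk2 l2
        apply Real.exp_le_exp.2; linarith
  push Not at hk2
  have hUk := hS T hT
  set U := ∑ j ∈ T \ S, u j with hU
  have hkpos : 0 < k := by linarith
  have hUpos : 0 < U := by linarith
  have hdrop : ∀ j ∈ T \ S, codeRank N (T.erase j) - codeRank N S ≤ k - 1 ∧ S ⊆ T.erase j := by
    intro j hj
    have h1 := codeRank_add_one_le N (erase_subset j T) (hrel j hj)
    exact ⟨by linarith, subset_erase.2 ⟨hT, (mem_sdiff.1 hj).2⟩⟩
  have hk1 : 1 ≤ k := by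
    have hne : (T \ S).Nonempty := by
      by_contra h
      rw [not_nonempty_iff_eq_empty] at h
      rw [hU, h] at hUpos; simp at hUpos
    obtain ⟨j, hj⟩ := hne
    obtain ⟨h1, h2⟩ := hdrop j hj
    have := codeRank_mono N h2
    linarith
  set W : Finset ι → Finset (Finset ι) :=
    fun T => (contractedSupports N S T).filter fun D => ∑ j ∈ D, u j ≤ α with hW
  set M := Real.exp (α * (2 * Real.log 2 + 4 * Real.log k)) with hM
  have hstep : ∀ j ∈ T \ S, (#((W T).filter fun D => j ∉ D) : ℝ) ≤ M := by
    intro j hj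
    obtain ⟨h1, h2⟩ := hdrop j hj
    have h3 := codeRank_mono N h2
    have h4 := ih #(T.erase j) (by rw [← hn]; exact card_erase_lt_of_mem (mem_sdiff.1 hj).1)
      (T.erase j) rfl h2
    have hsub : (W T).filter (fun D => j ∉ D) ⊆ W (T.erase j) := by
      intro D hD
      simp only [hW, mem_filter, mem_contractedSupports] at hD ⊢
      obtain ⟨⟨⟨h, hh, rfl⟩, hD2⟩, hjD⟩ := hD
      refine ⟨⟨h, ?_, rfl⟩, hD2⟩
      rw [mem_supportedIn_iff_codeSupp_subset] at hh ⊢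
      refine subset_erase.2 ⟨hh, fun hj' => hjD (mem_sdiff.2 ⟨hj', (mem_sdiff.1 hj).2⟩)⟩
    calc (#((W T).filter fun D => j ∉ D) : ℝ) ≤ #(W (T.erase j)) := by
          exact_mod_cast card_le_card hsub
      _ ≤ _ := h4
      _ ≤ M := by
        rw [hM]
        have := Real.log_le_log (by linarith) (by linarith : codeRank N (T.erase j) - codeRank N S + 1 ≤ k)
        gcongr
  have hDT : ∀ D ∈ W T, D ⊆ T \ S := by
    intro D hD
    simp only [hW, mem_filter, mem_contractedSupports] at hD
    obtain ⟨⟨h, hh, rfl⟩, -⟩ := hD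
    exact sdiff_subset_sdiff ((mem_supportedIn_iff_codeSupp_subset N).1 hh) le_rfl
  have hdc : ∑ j ∈ T \ S, u j * #((W T).filter fun D => j ∉ D) = ∑ D ∈ W T, (U - ∑ j ∈ D, u j) := by
    have e1 : ∀ j, u j * (#((W T).filter fun D => j ∉ D) : ℝ)
        = ∑ D ∈ W T, if j ∉ D then u j else 0 := by
      intro j; rw [← sum_filter, sum_const, nsmul_eq_mul, mul_comm]
    simp_rw [e1]
    rw [sum_comm]
    refine sum_congr rfl fun D hD => ?_
    rw [← sum_filter, hU, ← sum_sdiff (hDT D hD), add_sub_cancel_right]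
    congr 1; ext j; simp
  have hlow : (#(W T) : ℝ) * (U - α) ≤ ∑ D ∈ W T, (U - ∑ j ∈ D, u j) := by
    rw [← nsmul_eq_mul]
    refine card_nsmul_le_sum _ _ _ fun D hD => ?_
    have := (mem_filter.1 hD).2
    linarith
  have hupp : ∑ j ∈ T \ S, u j * #((W T).filter fun D => j ∉ D) ≤ U * M := by
    rw [hU, sum_mul]
    exact sum_le_sum fun j hj => mul_le_mul_of_nonneg_left (hstep j hj) (hu j)
  have hmain : (#(W T) : ℝ) * (1 - α / k) ≤ M := by
    have h1 : (#(W T) : ℝ) * (1 - α / k) ≤ #(W T) * (1 - α / U) := by gcongr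
    have h2 : (#(W T) : ℝ) * (1 - α / U) = #(W T) * (U - α) / U := by field_simp
    rw [h2] at h1
    refine h1.trans ((div_le_iff₀ hUpos).2 ?_)
    linarith
  have hpos : 0 < 1 - α / k := by
    have : α / k < 1 := (div_lt_one hkpos).2 (by linarith)
    linarith
  refine le_of_mul_le_mul_right (hmain.trans ?_) hpos
  rw [hM, mul_add, mul_add, Real.exp_add, Real.exp_add, mul_assoc]
  exact mul_le_mul_of_nonneg_left (exp_mul_log_le hα hk1 hk2.le) (Real.exp_pos _).le

end Counting

open Finset in
theorem sum_exp_neg_le_of_card_le {τ : Type*} (s : Finset τ) (a : τ → ℝ) {β γ : ℝ}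
    (ha : ∀ i ∈ s, 1 ≤ a i) (hβ : 0 ≤ β) (hγ : Real.log 2 ≤ γ)
    (hcard : ∀ α : ℝ, 0 ≤ α → (#(s.filter fun i => a i ≤ α) : ℝ) ≤ Real.exp (α * β)) :
    ∑ i ∈ s, Real.exp (-((2 * β + γ) * a i)) ≤ 2 * Real.exp (-γ) := by
  have hγ0 : 0 ≤ γ := (Real.log_nonneg (by norm_num)).trans hγ
  set q := Real.exp (-γ) with hq
  have hq2 : q ≤ 1 / 2 := by
    rw [hq, one_div, ← Real.exp_log (show (0 : ℝ) < 2 by norm_num), ← Real.exp_neg]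
    exact Real.exp_le_exp.2 (by linarith)
  have hq0 : 0 ≤ q := (Real.exp_pos _).le
  obtain ⟨M, hM⟩ : ∃ M : ℕ, ∀ i ∈ s, ⌊a i⌋₊ - 1 ∈ range M :=
    ⟨s.sup (fun i => ⌊a i⌋₊ - 1) + 1, fun i hi => mem_range.2
      (Nat.lt_succ_of_le (le_sup (f := fun i => ⌊a i⌋₊ - 1) hi))⟩
  rw [← sum_fiberwise_of_maps_to hM]
  have hfib : ∀ n ∈ range M, ∑ i ∈ s with ⌊a i⌋₊ - 1 = n, Real.exp (-((2 * β + γ) * a i))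
      ≤ q * (1 / 2) ^ n := by
    intro n _
    have hfl : ∀ i ∈ s, ⌊a i⌋₊ - 1 = n → (n : ℝ) + 1 ≤ a i ∧ a i ≤ n + 2 := by
      intro i hi hn
      have h1 : 1 ≤ ⌊a i⌋₊ := Nat.one_le_floor_iff _ |>.2 (ha i hi)
      have h2 : ⌊a i⌋₊ = n + 1 := by omega
      have h3 := Nat.floor_le (by linarith [ha i hi] : 0 ≤ a i)
      have h4 := Nat.lt_floor_add_one (a i)
      rw [h2] at h3 h4
      push_cast at h3 h4
      exact ⟨h3, by linarith⟩
    calc _ ≤ ∑ i ∈ s with ⌊a i⌋₊ - 1 = n, Real.exp (-((2 * β + γ) * (n + 1))) := by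
          refine sum_le_sum fun i hi => Real.exp_le_exp.2 (neg_le_neg ?_)
          obtain ⟨hi, hn⟩ := mem_filter.1 hi
          exact mul_le_mul_of_nonneg_left (hfl i hi hn).1 (by linarith)
      _ = #(s.filter fun i => ⌊a i⌋₊ - 1 = n) * Real.exp (-((2 * β + γ) * (n + 1))) := by
          rw [sum_const, nsmul_eq_mul]
      _ ≤ Real.exp ((n + 2) * β) * Real.exp (-((2 * β + γ) * (n + 1))) := by
          gcongr
          refine le_trans ?_ (hcard (n + 2) (by positivity))
          refine Nat.cast_le.2 (card_le_card fun i hi => ?_)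
          obtain ⟨hi, hn⟩ := mem_filter.1 hi
          exact mem_filter.2 ⟨hi, (hfl i hi hn).2⟩
      _ = Real.exp ((n + 2) * β + -((2 * β + γ) * (n + 1))) := by rw [Real.exp_add]
      _ ≤ Real.exp ((n + 1 : ℕ) * -γ) := by
          apply Real.exp_le_exp.2
          push_cast
          nlinarith [mul_nonneg (Nat.cast_nonneg (α := ℝ) n) hβ]
      _ = q * q ^ n := by rw [Real.exp_nat_mul, pow_succ']
      _ ≤ _ := by gcongr
  refine (sum_le_sum hfib).trans ?_
  rw [← mul_sum, mul_comm]
  exact mul_le_mul_of_nonneg_right (sum_geometric_two_le M) hq0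

open Classical Finset in
theorem sum_exp_contractedSupports_le {G ι : Type*} [AddCommGroup G] [Finite G] [Fintype ι]
    (N : ι → AddSubgroup G) {u : ι → ℝ} (hu : ∀ j, 0 ≤ u j) {S : Finset ι}
    (hS : ∀ T, S ⊆ T → codeRank N T - codeRank N S ≤ ∑ j ∈ T \ S, u j)
    {K γ : ℝ} (hK : codeRank N univ ≤ K) (hγ : Real.log 2 ≤ γ) :
    ∑ D ∈ (contractedSupports N S univ).filter (·.Nonempty),
      Real.exp (-((2 * (2 * Real.log 2 + 4 * Real.log (K + 1)) + γ) * ∑ j ∈ D, u j))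
        ≤ 2 * Real.exp (-γ) := by
  have h0 := codeRank_nonneg N S
  have hmono := codeRank_mono N (subset_univ S)
  refine sum_exp_neg_le_of_card_le _ (fun D => ∑ j ∈ D, u j) ?_ ?_ hγ fun α hα => ?_
  · intro D hD
    obtain ⟨hD, hne⟩ := mem_filter.1 hD
    obtain ⟨h, -, rfl⟩ := (mem_contractedSupports N).1 hD
    have hsub : S ⊆ S ∪ codeSupp N h := subset_union_left
    have h1 := hS _ hsub
    rw [union_sdiff_left] at h1
    have h2 := codeRank_add_one_le N hsub fun he => by
      have : h ∈ supportedIn N (S ∪ codeSupp N h) :=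
        (mem_supportedIn_iff_codeSupp_subset N).2 subset_union_right
      rw [← he, mem_supportedIn_iff_codeSupp_subset, ← sdiff_eq_empty_iff_subset] at this
      exact hne.ne_empty this
    linarith
  · have := Real.log_nonneg (show 1 ≤ K + 1 by linarith)
    have := Real.log_nonneg (show (1 : ℝ) ≤ 2 by norm_num)
    linarith
  · refine le_trans ?_ ((card_light_contractedSupports_le N hu hS hα univ (subset_univ _)).trans ?_)
    · exact Nat.cast_le.2 (card_le_card (filter_subset_filter _ (filter_subset _ _)))
    · have := Real.log_le_log (by linarith)
        (by linarith : codeRank N univ - codeRank N S + 1 ≤ K + 1)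
      gcongr

open Classical Finset in
/-- Near-linear size sparsifiers for codes over a finite group. -/
theorem exists_code_sparsifier {G ι : Type*} [AddCommGroup G] [Finite G] [Fintype ι]
    (N : ι → AddSubgroup G) {w : ι → ℝ} (hw : ∀ j, 0 < w j) {ε K : ℝ} (hε : 0 < ε) (hε1 : ε < 1)
    (hK : Real.logb 2 (Nat.card G) ≤ K) :
    ∃ (X : Finset ι) (w' : ι → ℝ), (∀ j, 0 ≤ w' j) ∧ (∀ j ∉ X, w' j = 0) ∧
      (#X : ℝ) ≤ 2 + 4 * K * (7 + 9 * Real.logb 2 (K + 1)) / ε ^ 2 ∧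
      ∀ h : G, |∑ j ∈ codeSupp N h, w' j - ∑ j ∈ codeSupp N h, w j|
        ≤ ε * ∑ j ∈ codeSupp N h, w j := by
  have hrK : codeRank N univ ≤ K := (codeRank_le N _).trans hK
  have h0 := codeRank_nonneg N ∅
  have hK0 : 0 ≤ K := (codeRank_nonneg N _).trans hrK
  obtain ⟨u, L, c, hu, -, husum, hL, hLcard, hwu⟩ := exists_levels
    (f := codeRank N) (fun S T => codeRank_mono N) (codeRank_supermodular N)
    (fun S T hST hlt => codeRank_add_one_le N hST fun he => hlt.ne (by rw [codeRank, he]; rfl))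
    hw ∅ 0 le_rfl (fun T _ => by simpa using sum_nonneg fun j _ => (hw j).le)
  have husum' : ∑ j, u j ≤ K := by rw [sdiff_empty] at husum; linarith
  set γ := Real.log (8 * (K + 1)) with hγ
  have hl2 : 0 < Real.log 2 := Real.log_pos (by norm_num)
  have hlK : 0 ≤ Real.log (K + 1) := Real.log_nonneg (by linarith)
  have hγ' : γ = 3 * Real.log 2 + Real.log (K + 1) := by
    rw [hγ, Real.log_mul (by norm_num) (by positivity), show (8 : ℝ) = 2 ^ 3 by norm_num,
      Real.log_pow]
    norm_num
  set B := 2 * (2 * Real.log 2 + 4 * Real.log (K + 1)) + γ with hB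
  have hBpos : 0 < B := by rw [hB, hγ']; linarith
  set η := ε ^ 2 / (4 * B) with hη
  have hηpos : 0 < η := by positivity
  have hεη : ε ^ 2 / (4 * η) = B := by rw [hη]; field_simp
  obtain ⟨s, hs⟩ : ∃ s : Finset ((_ : Finset ι) × Finset ι),
      s = L.sigma fun R => (contractedSupports N R univ).filter (·.Nonempty) := ⟨_, rfl⟩
  have hfail : ∑ x ∈ s, 2 * Real.exp (-(ε ^ 2 / (4 * η) * ∑ j ∈ x.2, u j)) ≤ 1 / 2 := by
    rw [hεη, hs, sum_sigma]
    calc _ ≤ ∑ R ∈ L, 2 * (2 * Real.exp (-γ)) := by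
          refine sum_le_sum fun R hR => ?_
          rw [← mul_sum]
          exact mul_le_mul_of_nonneg_left (sum_exp_contractedSupports_le N hu (hL R hR).2.2 hrK
            (by rw [hγ']; linarith)) (by norm_num)
      _ = #L * (1 / (2 * (K + 1))) := by
          rw [sum_const, nsmul_eq_mul, hγ, Real.exp_neg, Real.exp_log (by positivity)]
          field_simp; norm_num
      _ ≤ (K + 1) * (1 / (2 * (K + 1))) := by gcongr; linarith
      _ = 1 / 2 := by field_simp
  obtain ⟨X, hX, htest⟩ := exists_sample hu hηpos hε hε1 s (fun x => x.2) hfail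
  refine ⟨X, fun j => if j ∈ X then ∑ R ∈ L, if j ∈ R then 0 else c R * max (u j) η else 0,
    fun j => ?_, fun j hj => if_neg hj, ?_, fun h => ?_⟩
  · dsimp only
    split_ifs
    · refine sum_nonneg fun R hR => ?_
      split_ifs
      · exact le_rfl
      · exact mul_nonneg (hL R hR).2.1 (le_max_of_le_left (hu j))
    · exact le_rfl
  · have h1 : (∑ j, u j) / η ≤ K / η := by gcongr
    have h2 : K / η = 4 * K * (7 + 9 * Real.logb 2 (K + 1)) / ε ^ 2 * Real.log 2 := by
      rw [hη, hB, hγ', Real.logb]; field_simp; ring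
    rw [h2] at h1
    refine le_of_mul_le_mul_right ?_ hl2
    rw [add_mul]; linarith
  · have hexp : ∀ g : ι → ℝ, ∑ j ∈ codeSupp N h, ∑ R ∈ L, (if j ∈ R then 0 else c R * g j)
        = ∑ R ∈ L, c R * ∑ j ∈ codeSupp N h \ R, g j := by
      intro g
      rw [sum_comm]
      refine sum_congr rfl fun R _ => ?_
      rw [mul_sum, sdiff_eq_filter, sum_filter]
      exact sum_congr rfl fun j _ => by split_ifs <;> simp_all
    have hwsum : ∑ j ∈ codeSupp N h, w j = ∑ R ∈ L, c R * ∑ j ∈ codeSupp N h \ R, u j := by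
      rw [← hexp]
      refine sum_congr rfl fun j hj => ?_
      rw [hwu j (notMem_empty j), zero_mul, zero_add]
      have := codeRank_add_one_le N (erase_subset j univ) fun he => by
        have h1 : h ∈ supportedIn N univ := (mem_supportedIn N).2 (by simp)
        rw [← he, mem_supportedIn] at h1
        exact (mem_codeSupp N).1 hj (h1 j (by simp))
      linarith
    have hw'sum : ∑ j ∈ codeSupp N h,
        (if j ∈ X then ∑ R ∈ L, (if j ∈ R then 0 else c R * max (u j) η) else 0)
        = ∑ R ∈ L, c R * ∑ j ∈ codeSupp N h \ R, (if j ∈ X then max (u j) η else 0) := by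
      rw [← hexp]
      refine sum_congr rfl fun j _ => ?_
      split_ifs with hj
      · rfl
      · simp
    rw [hw'sum, hwsum, ← sum_sub_distrib, mul_sum]
    refine (abs_sum_le_sum_abs _ _).trans (sum_le_sum fun R hR => ?_)
    have hc := (hL R hR).2.1
    rw [← mul_sub, abs_mul, abs_of_nonneg hc, mul_left_comm]
    refine mul_le_mul_of_nonneg_left ?_ hc
    rcases (codeSupp N h \ R).eq_empty_or_nonempty with he | hne
    · simp [he]
    · exact htest ⟨R, codeSupp N h \ R⟩ (hs ▸ mem_sigma.2 ⟨hR, mem_filter.2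
        ⟨(mem_contractedSupports N).2 ⟨h, (mem_supportedIn N).2 (by simp), rfl⟩, hne⟩⟩)

/-- An affine predicate sparsifier reduces to a code sparsifier. -/
theorem exists_affine_sparsifier {A : Type} [AddCommGroup A] [Fintype A] {n r m : ℕ}
    (P : (Fin r → Bool) → Bool) (av : Fin r → A) (b : A)
    (hP : ∀ x : Fin r → Bool, P x = true ↔ (∑ i, if x i then av i else 0) ≠ b)
    {ε K : ℝ} (hε : 0 < ε) (hε1 : ε < 1) (w : Fin m → ℝ) (t : Fin m → Fin r → Fin n)
    (hw : ∀ j, 0 ≤ w j) (hK : (n + 1) * Real.logb 2 (Fintype.card A) ≤ K) :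
    ∃ (S : Finset (Fin m)) (w' : Fin m → ℝ), (∀ j ∈ S, 0 ≤ w' j) ∧
      (S.card : ℝ) ≤ 2 + 4 * K * (7 + 9 * Real.logb 2 (K + 1)) / ε ^ 2 ∧
      ∀ a : Fin n → Bool,
        (1 - ε) * cspVal P w t a ≤ cspValOn P S w' t a ∧
        cspValOn P S w' t a ≤ (1 + ε) * cspVal P w t a := by
  set q := Fintype.card A with hq
  have hqpos : 0 < q := Fintype.card_pos
  have : NeZero q := ⟨hqpos.ne'⟩
  let _ : Module (ZMod q) A := AddCommGroup.zmodModule fun x => card_nsmul_eq_zero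
  let φ : Fin m → ((Fin n → ZMod q) × ZMod q) →+ A := fun j =>
    { toFun := fun x => ∑ i, x.1 (t j i) • av i - x.2 • b
      map_zero' := by simp
      map_add' := fun x y => by
        simp only [Prod.fst_add, Prod.snd_add, Pi.add_apply, add_smul, Finset.sum_add_distrib]
        abel }
  let N : Fin m → AddSubgroup ((Fin n → ZMod q) × ZMod q) := fun j =>
    if 0 < w j then (φ j).ker else ⊤
  obtain ⟨X, w', hw', hw'X, hX, happ⟩ := exists_code_sparsifier N
    (w := fun j => if 0 < w j then w j else 1) (K := K)
    (fun j => by split_ifs with h; exacts [h, one_pos]) hε hε1 (by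
      refine le_trans (le_of_eq ?_) hK
      rw [Nat.card_prod, Nat.card_fun, Nat.card_zmod, Nat.card_eq_fintype_card, Fintype.card_fin]
      rw [← pow_succ, Nat.cast_pow, Real.logb_pow]; push_cast; rfl)
  refine ⟨X.filter fun j => 0 < w j, w', fun j _ => hw' j, le_trans ?_ hX, fun a => ?_⟩
  · exact_mod_cast Finset.card_filter_le _ _
  let h : (Fin n → ZMod q) × ZMod q := (fun v => if a v then 1 else 0, 1)
  have hmem : ∀ j, j ∈ codeSupp N h ↔ 0 < w j ∧ P (fun k => a (t j k)) = true := by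
    intro j
    rw [mem_codeSupp, hP]
    by_cases hj : 0 < w j
    · simp [N, hj, AddMonoidHom.mem_ker, φ, h, sub_eq_zero, ite_smul]
    · simp [N, hj]
  have hval : ∑ j ∈ codeSupp N h, (if 0 < w j then w j else 1) = cspVal P w t a := by
    rw [cspVal, ← Finset.sum_subset (Finset.subset_univ (codeSupp N h))]
    · refine Finset.sum_congr rfl fun j hj => ?_
      obtain ⟨h1, h2⟩ := (hmem j).1 hj
      rw [if_pos h1, if_pos h2, mul_one]
    · intro j _ hj
      rw [hmem, not_and] at hj
      rcases (hw j).eq_or_lt with h' | h'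
      · rw [← h', zero_mul]
      · rw [if_neg (hj h'), mul_zero]
  have hvalOn : ∑ j ∈ codeSupp N h, w' j
      = cspValOn P (X.filter fun j => 0 < w j) w' t a := by
    simp only [cspValOn, mul_ite, mul_one, mul_zero]
    rw [← Finset.sum_filter]
    refine (Finset.sum_subset (fun j hj => ?_) fun j hj hj' => hw'X j fun hX => hj' ?_).symm
    · simp only [Finset.mem_filter] at hj
      exact (hmem j).2 ⟨hj.1.2, hj.2⟩
    · obtain ⟨h1, h2⟩ := (hmem j).1 hj
      simp [hX, h1, h2]
  have := happ h
  rw [hval, hvalOn, abs_le] at this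
  constructor <;> linarith

/-- near-linear size sparsifiers for CSPs over affine predicates over
finite Abelian groups. -/
theorem stmt_4 :
    ∃ K c : ℝ, 0 < K ∧ 0 < c ∧
      ∀ (A : Type) [AddCommGroup A] [Fintype A], 2 ≤ Fintype.card A →
      ∀ (r : ℕ), 1 ≤ r →
      ∀ P : (Fin r → Bool) → Bool,
        (∃ (av : Fin r → A) (b : A), ∀ x : Fin r → Bool,
          (P x = true ↔ (∑ i, if x i then av i else 0) ≠ b)) →
      ∀ ε : ℝ, 0 < ε → ε < 1 → ∀ n : ℕ, 1 ≤ n →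
      ∀ (m : ℕ) (w : Fin m → ℝ) (t : Fin m → Fin r → Fin n), (∀ j, 0 ≤ w j) →
      ∃ (S : Finset (Fin m)) (w' : Fin m → ℝ),
        (∀ j ∈ S, 0 ≤ w' j) ∧
        (S.card : ℝ) ≤ K * n * (Real.logb 2 (2 * (Fintype.card A : ℝ))) ^ 2 *
          (Real.logb 2 (2 * (n : ℝ) * (Fintype.card A : ℝ) * (r : ℝ) / ε)) ^ c / ε ^ 2 ∧
        ∀ a : Fin n → Bool,
          (1 - ε) * cspVal P w t a ≤ cspValOn P S w' t a ∧
          cspValOn P S w' t a ≤ (1 + ε) * cspVal P w t a := by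
  refine ⟨1000, 1, by norm_num, one_pos, ?_⟩
  rintro A _ _ hA r hr P ⟨av, b, hP⟩ ε hε hε1 n hn m w t hw
  obtain ⟨S, w', h1, h2, h3⟩ := exists_affine_sparsifier P av b hP hε hε1 w t hw le_rfl
  refine ⟨S, w', h1, h2.trans ?_, h3⟩
  rw [Real.rpow_one]
  have hQ : (2 : ℝ) ≤ Fintype.card A := by exact_mod_cast hA
  have hN : (1 : ℝ) ≤ n := by exact_mod_cast hn
  have hR : (1 : ℝ) ≤ r := by exact_mod_cast hr
  generalize (Fintype.card A : ℝ) = Q at *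
  generalize (n : ℝ) = x at *
  generalize (r : ℝ) = ρ at *
  set ℓ := Real.logb 2 Q with hℓ
  set Λ := Real.logb 2 (2 * x * Q * ρ / ε) with hΛ
  have hℓ1 : 1 ≤ ℓ := by
    rw [hℓ, Real.le_logb_iff_rpow_le (by norm_num) (by linarith)]; simpa using hQ
  have hℓQ : ℓ ≤ 2 * Q := by
    have h4 := Real.log_le_sub_one_of_pos (show 0 < Q by linarith)
    have h5 := Real.log_two_gt_d9
    rw [hℓ, Real.logb, div_le_iff₀ (by linarith)]
    nlinarith
  have hb : Real.logb 2 (2 * Q) = ℓ + 1 := by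
    rw [Real.logb_mul (by norm_num) (by linarith), Real.logb_self_eq_one (by norm_num)]; ring
  have hxQ : 2 ≤ x * Q := by nlinarith
  have hle : 2 * (x * Q) ≤ 2 * x * Q * ρ / ε := by
    rw [le_div_iff₀ hε]
    have e1 : 2 * (x * Q) * ε ≤ 2 * (x * Q) * 1 := by gcongr
    have e2 : 2 * (x * Q) * 1 ≤ 2 * (x * Q) * ρ := by gcongr
    linarith
  have hΛ2 : 2 ≤ Λ := by
    rw [hΛ, Real.le_logb_iff_rpow_le (by norm_num) (by linarith)]
    norm_num; linarith
  have hlogK : Real.logb 2 ((x + 1) * ℓ + 1) ≤ 2 * Λ := by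
    have e1 : (x + 1) * ℓ + 1 ≤ (2 * (x * Q)) ^ 2 := by
      have : (x + 1) * ℓ ≤ (2 * x) * (2 * Q) := by gcongr; linarith
      nlinarith
    calc Real.logb 2 ((x + 1) * ℓ + 1) ≤ Real.logb 2 ((2 * x * Q * ρ / ε) ^ 2) :=
          Real.logb_le_logb_of_le (by norm_num) (by nlinarith) (e1.trans (by gcongr))
      _ = 2 * Λ := by rw [Real.logb_pow, hΛ]; norm_num
  have hε2 : ε ^ 2 ≤ 1 := by nlinarith
  have hεp : 0 < ε ^ 2 := by positivity
  rw [hb, le_div_iff₀ hεp, add_mul, div_mul_cancel₀ _ hεp.ne']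
  have g1 : 4 * ((x + 1) * ℓ) * (7 + 9 * Real.logb 2 ((x + 1) * ℓ + 1))
      ≤ 4 * ((2 * x) * ℓ) * (7 * Λ + 9 * (2 * Λ)) := by
    have hlog0 : 0 ≤ Real.logb 2 ((x + 1) * ℓ + 1) :=
      Real.logb_nonneg (by norm_num) (by nlinarith)
    gcongr <;> linarith
  have g2 : 1 ≤ x * ℓ * Λ := by
    have : 1 ≤ x * ℓ := by nlinarith
    nlinarith
  have g3 : x * ℓ * Λ ≤ x * (ℓ + 1) ^ 2 * Λ := by
    gcongr; nlinarith
  linarith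
end
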